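/- arXiv:2503.00927 — 7 statements merged into one kernel-verified Lean document; each statement's English description precedes it below -/
import Mathlib

section
/- Let φ : ℝⁿ → ℝ be of class C^{1,1} and let a, b ∈ ℝⁿ. Then there exist points ξ and ξ' on the segment [a, b] and vectors z ∈ ∂²φ(ξ)(b − a) and z' ∈ ∂²φ(ξ')(b − a) such that (1/2)⟨z', b − a⟩ ≤ φ(b) − φ(a) − ⟨∇φ(a), b − a⟩ ≤ (1/2)⟨z, b − a⟩. -/
open Filter Topology RealInnerProductSpace

noncomputable section

/-- `ℝⁿ` with the Euclidean structure. -/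
abbrev En (n : ℕ) : Type := EuclideanSpace ℝ (Fin n)

/-- `φ` is of class `C^{1,1}`: Fréchet differentiable with locally Lipschitz gradient. -/
def IsC11 {n : ℕ} (φ : En n → ℝ) : Prop :=
  Differentiable ℝ φ ∧ LocallyLipschitz (fun x => gradient φ x)

/-- Fréchet subdifferential of `h` at `x`. -/
def frechetSubdiff {n : ℕ} (h : En n → ℝ) (x : En n) : Set (En n) :=
  {v | 0 ≤ Filter.liminf (fun y => (h y - h x - ⟪v, y - x⟫) / ‖y - x‖) (𝓝[≠] x)}

/-- Limiting (Mordukhovich) subdifferential of `h` at `xb`. -/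
def limitingSubdiff {n : ℕ} (h : En n → ℝ) (xb : En n) : Set (En n) :=
  {v | ∃ x : ℕ → En n, ∃ w : ℕ → En n,
      Tendsto x atTop (𝓝 xb) ∧ Tendsto w atTop (𝓝 v) ∧
      ∀ k, w k ∈ frechetSubdiff h (x k)}

/-- Limiting second-order subdifferential `∂²φ(xb)(u) = ∂⟨u, ∇φ⟩(xb)`. -/
def secondSubdiff {n : ℕ} (φ : En n → ℝ) (xb u : En n) : Set (En n) :=
  limitingSubdiff (fun x => ⟪u, gradient φ x⟫) xb

/-- `max{⟨ζ, u⟩ : ζ ∈ ∂²φ(xb)(u)}`. -/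
def d2max {n : ℕ} (φ : En n → ℝ) (xb u : En n) : ℝ :=
  sSup ((fun ζ => ⟪ζ, u⟫) '' secondSubdiff φ xb u)

/-- `min{⟨ζ, u⟩ : ζ ∈ ∂²φ(xb)(u)}`. -/
def d2min {n : ℕ} (φ : En n → ℝ) (xb u : En n) : ℝ :=
  sInf ((fun ζ => ⟪ζ, u⟫) '' secondSubdiff φ xb u)

/-- Tangent cone (via sequences). -/
def tangentCone {n : ℕ} (Ω : Set (En n)) (xb : En n) : Set (En n) :=
  {d | ∃ t : ℕ → ℝ, ∃ dk : ℕ → En n,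
      (∀ k, 0 < t k) ∧ Tendsto t atTop (𝓝 0) ∧ Tendsto dk atTop (𝓝 d) ∧
      ∀ k, xb + t k • dk k ∈ Ω}

/-- Second-order tangent set. -/
def secondTangent {n : ℕ} (Ω : Set (En n)) (xb u : En n) : Set (En n) :=
  {v | ∃ t : ℕ → ℝ, ∃ vk : ℕ → En n,
      (∀ k, 0 < t k) ∧ Tendsto t atTop (𝓝 0) ∧ Tendsto vk atTop (𝓝 v) ∧
      ∀ k, xb + t k • u + ((1 : ℝ) / 2 * (t k) ^ 2) • vk k ∈ Ω}

/-- Lexicographic `≤` on `ℝ²`. -/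
def lexLe (a b : ℝ × ℝ) : Prop := a.1 < b.1 ∨ (a.1 = b.1 ∧ a.2 ≤ b.2)

/-- Lexicographic `<` on `ℝ²`. -/
def lexLt (a b : ℝ × ℝ) : Prop := a.1 < b.1 ∨ (a.1 = b.1 ∧ a.2 < b.2)

lemma aux_frechet {n : ℕ} (h : En n → ℝ) (hh : LocallyLipschitz h) (x w : En n) (k : ℝ) (hk : 0 ≤ k)
    (H : ∀ᶠ y in 𝓝 x, -(k * ‖y - x‖ ^ 2) ≤ h y - h x - ⟪w, y - x⟫) :
    w ∈ frechetSubdiff h x := by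
  show 0 ≤ Filter.liminf (fun y => (h y - h x - ⟪w, y - x⟫) / ‖y - x‖) (𝓝[≠] x)
  rcases eq_or_neBot (𝓝[≠] x) with hb | hb
  · rw [hb]
    simp [Filter.liminf, Filter.limsInf]
  · obtain ⟨L, t, ht, hL⟩ := hh x
    have hxt : x ∈ t := mem_of_mem_nhds ht
    have hup : ∀ᶠ y in 𝓝[≠] x, (h y - h x - ⟪w, y - x⟫) / ‖y - x‖ ≤ L + ‖w‖ := by
      filter_upwards [nhdsWithin_le_nhds ht, self_mem_nhdsWithin] with y hy hne
      have hpos : 0 < ‖y - x‖ := norm_pos_iff.2 (sub_ne_zero.2 hne)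
      rw [div_le_iff₀ hpos]
      have h1 := hL.norm_sub_le hy hxt
      have h2 := abs_real_inner_le_norm w (y - x)
      rw [Real.norm_eq_abs] at h1
      have h3 := le_abs_self (h y - h x)
      have h4 := neg_abs_le (⟪w, y - x⟫)
      nlinarith
    refine le_of_forall_lt fun c hc => lt_of_lt_of_le (b := c / 2) (by linarith) ?_
    refine le_liminf_of_le ?_ ?_
    · exact (isBoundedUnder_of_eventually_le hup).isCoboundedUnder_ge
    · have hsmall : ∀ᶠ y in 𝓝[≠] x, k * ‖y - x‖ < -(c / 2) := by
        apply nhdsWithin_le_nhds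
        have hc : ContinuousAt (fun y : En n => k * ‖y - x‖) x := by fun_prop
        apply hc.eventually_lt_const
        simp; linarith
      filter_upwards [nhdsWithin_le_nhds H, hsmall, self_mem_nhdsWithin] with y hy hs hne
      have hpos : 0 < ‖y - x‖ := norm_pos_iff.2 (sub_ne_zero.2 hne)
      rw [le_div_iff₀ hpos]
      nlinarith

lemma aux_mvt {n : ℕ} (h : En n → ℝ) (hh : LocallyLipschitz h) (p v : En n) :
    ∃ t ∈ Set.Icc (0 : ℝ) 1, ∃ z ∈ limitingSubdiff h (p + t • v),
      h (p + v) - h p ≤ ⟪z, v⟫ := by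
  have hcont : Continuous h := hh.continuous
  set c := h (p + v) - h p with hc
  -- minimizer on the segment
  obtain ⟨t0, ht0, ht01, hmin⟩ : ∃ t0 ∈ Set.Icc (0 : ℝ) 1, t0 < 1 ∧
      ∀ t ∈ Set.Icc (0 : ℝ) 1, h (p + t0 • v) - c * t0 ≤ h (p + t • v) - c * t := by
    have hr : Continuous (fun t : ℝ => h (p + t • v) - c * t) := by fun_prop
    obtain ⟨t1, ht1, hm⟩ := (isCompact_Icc (a := (0:ℝ)) (b := 1)).exists_isMinOn
      ⟨0, by simp⟩ hr.continuousOn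
    rcases lt_or_eq_of_le ht1.2 with hlt | heq
    · exact ⟨t1, ht1, hlt, fun t ht => hm ht⟩
    · refine ⟨0, by simp, by norm_num, fun t ht => ?_⟩
      have := hm ht
      simp only [heq, Set.mem_setOf_eq] at this
      simp only [one_smul, zero_smul, add_zero] at this ⊢
      linarith
  set x0 := p + t0 • v with hx0
  let K : Set (En n × ℝ) := Metric.closedBall x0 1 ×ˢ Set.Icc (0 : ℝ) 1
  have hK : IsCompact K := (isCompact_closedBall x0 1).prod isCompact_Icc
  have hmem0 : (x0, t0) ∈ K := ⟨by simp, ht0⟩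
  have hex : ∀ k : ℕ, ∃ y ∈ K, ∀ y' ∈ K,
      h y.1 - c * y.2 + k * ‖y.1 - p - y.2 • v‖ ^ 2 + (y.2 - t0) ^ 2 ≤
      h y'.1 - c * y'.2 + k * ‖y'.1 - p - y'.2 • v‖ ^ 2 + (y'.2 - t0) ^ 2 := by
    intro k
    have hF : Continuous (fun y : En n × ℝ =>
      h y.1 - c * y.2 + k * ‖y.1 - p - y.2 • v‖ ^ 2 + (y.2 - t0) ^ 2) := by fun_prop
    obtain ⟨y, hy, hm⟩ := hK.exists_isMinOn ⟨_, hmem0⟩ hF.continuousOn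
    exact ⟨y, hy, fun y' hy' => hm hy'⟩
  choose Y hYK hYmin using hex
  obtain ⟨⟨xb, tb⟩, hbK, σ, hσ, hlim⟩ := hK.tendsto_subseq hYK
  have hlx : Tendsto (fun k => (Y (σ k)).1) atTop (𝓝 xb) := (continuous_fst.tendsto _).comp hlim
  have hlt : Tendsto (fun k => (Y (σ k)).2) atTop (𝓝 tb) := (continuous_snd.tendsto _).comp hlim
  have hbase : ∀ k, h (Y k).1 - c * (Y k).2 + k * ‖(Y k).1 - p - (Y k).2 • v‖ ^ 2
      + ((Y k).2 - t0) ^ 2 ≤ h x0 - c * t0 := by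
    intro k
    have := hYmin k _ hmem0
    simpa [hx0] using this
  -- the limit lies on the segment
  have hG : Tendsto (fun k => h (Y (σ k)).1 - c * (Y (σ k)).2 + ((Y (σ k)).2 - t0) ^ 2) atTop
      (𝓝 (h xb - c * tb + (tb - t0) ^ 2)) := by
    have : Continuous (fun y : En n × ℝ => h y.1 - c * y.2 + (y.2 - t0) ^ 2) := by fun_prop
    exact (this.tendsto (xb, tb)).comp hlim
  have hD : Tendsto (fun k => ‖(Y (σ k)).1 - p - (Y (σ k)).2 • v‖ ^ 2) atTop
      (𝓝 (‖xb - p - tb • v‖ ^ 2)) := by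
    have : Continuous (fun y : En n × ℝ => ‖y.1 - p - y.2 • v‖ ^ 2) := by fun_prop
    exact (this.tendsto (xb, tb)).comp hlim
  have hle1 : h xb - c * tb + (tb - t0) ^ 2 ≤ h x0 - c * t0 := by
    refine le_of_tendsto' hG fun k => ?_
    have := hbase (σ k)
    have h2 : 0 ≤ (σ k : ℝ) * ‖(Y (σ k)).1 - p - (Y (σ k)).2 • v‖ ^ 2 := by positivity
    linarith
  have hD0 : ‖xb - p - tb • v‖ ^ 2 = 0 := by
    by_contra hne
    have hpos : 0 < ‖xb - p - tb • v‖ ^ 2 := lt_of_le_of_ne (by positivity) (Ne.symm hne)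
    have hσt : Tendsto (fun k => (σ k : ℝ)) atTop atTop :=
      tendsto_natCast_atTop_atTop.comp hσ.tendsto_atTop
    have h1 := hσt.atTop_mul_pos hpos hD
    have h2 := h1.atTop_add hG
    obtain ⟨k, hk⟩ := (h2.eventually_gt_atTop (h x0 - c * t0)).exists
    have := hbase (σ k)
    linarith
  have hxb : xb = p + tb • v := by
    have : xb - p - tb • v = 0 := by simpa using hD0
    rw [sub_sub, sub_eq_zero] at this
    exact this
  have htb : tb = t0 := by
    have := hmin tb hbK.2
    rw [← hxb] at this
    have h3 : (tb - t0) ^ 2 ≤ 0 := by linarith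
    have h4 : tb - t0 = 0 := by nlinarith [sq_nonneg (tb - t0), pow_eq_zero_iff (two_ne_zero) |>.1 (le_antisymm h3 (sq_nonneg (tb - t0)))]
    linarith
  have hxx : xb = x0 := by rw [hxb, htb]
  subst htb
  rw [hxx] at hlx
  -- subgradients
  let W : ℕ → En n := fun k => (-(2 * (σ k : ℝ))) • ((Y (σ k)).1 - p - (Y (σ k)).2 • v)
  have hball : ∀ᶠ k in atTop, (Y (σ k)).1 ∈ Metric.ball x0 1 :=
    hlx.eventually (Metric.ball_mem_nhds x0 one_pos)
  have hsub : ∀ᶠ k in atTop, W k ∈ frechetSubdiff h (Y (σ k)).1 := by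
    filter_upwards [hball] with k hk
    refine aux_frechet h hh _ _ (σ k) (by positivity) ?_
    filter_upwards [Metric.isOpen_ball.mem_nhds hk] with y hy
    have := hYmin (σ k) (y, (Y (σ k)).2) ⟨Metric.ball_subset_closedBall hy, (hYK (σ k)).2⟩
    simp only at this
    have e : y - p - (Y (σ k)).2 • v =
        ((Y (σ k)).1 - p - (Y (σ k)).2 • v) + (y - (Y (σ k)).1) := by abel
    rw [e, norm_add_sq_real] at this
    simp only [W, real_inner_smul_left]
    linarith
  have hin : ∀ᶠ k in atTop, c - 2 * ((Y (σ k)).2 - tb) ≤ ⟪W k, v⟫ := by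
    filter_upwards [hlt.eventually_lt_const ht01] with k hk
    set t := (Y (σ k)).2 with ht
    set d := (Y (σ k)).1 - p - t • v with hd
    have htI : t ∈ Set.Icc (0:ℝ) 1 := (hYK (σ k)).2
    have key : ∀ s ∈ Set.Ioo (0:ℝ) (1 - t), c - 2 * (t - tb) - s * (σ k * ‖v‖ ^ 2 + 1) ≤ ⟪W k, v⟫ := by
      intro s hs
      have := hYmin (σ k) ((Y (σ k)).1, t + s) ⟨(hYK (σ k)).1, by
        constructor <;> [linarith [htI.1, hs.1]; linarith [hs.2]]⟩
      simp only [← ht, ← hd] at this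
      have e : (Y (σ k)).1 - p - (t + s) • v = d - s • v := by rw [hd, add_smul]; abel
      rw [e, norm_sub_sq_real d (s • v), real_inner_smul_right, norm_smul, mul_pow, Real.norm_eq_abs, sq_abs] at this
      simp only [W, real_inner_smul_left, ← hd]
      have hs0 := hs.1
      have h5 : 0 ≤ s * (-(2 * (σ k : ℝ)) * ⟪d, v⟫ - (c - 2 * (t - tb) - s * (σ k * ‖v‖ ^ 2 + 1))) := by
        nlinarith
      have := nonneg_of_mul_nonneg_right h5 hs0
      linarith
    have hev : ∀ᶠ s in 𝓝[>] (0:ℝ), c - 2 * (t - tb) - s * (σ k * ‖v‖ ^ 2 + 1) ≤ ⟪W k, v⟫ := by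
      filter_upwards [Ioo_mem_nhdsGT (show (0:ℝ) < 1 - t by linarith)] with s hs using key s hs
    have hcl : Tendsto (fun s : ℝ => c - 2 * (t - tb) - s * (σ k * ‖v‖ ^ 2 + 1)) (𝓝[>] 0)
        (𝓝 (c - 2 * (t - tb) - 0 * (σ k * ‖v‖ ^ 2 + 1))) := by
      apply Tendsto.mono_left _ nhdsWithin_le_nhds
      apply Continuous.tendsto (f := fun s : ℝ => c - 2 * (t - tb) - s * (σ k * ‖v‖ ^ 2 + 1))
      fun_prop
    have := le_of_tendsto hcl hev
    linarith
  obtain ⟨L, T, hT, hL⟩ := hh x0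
  have hseg : Tendsto (fun k => p + (Y (σ k)).2 • v) atTop (𝓝 x0) :=
    (hlt.smul_const v).const_add p
  have hbd : ∀ᶠ k in atTop, W k ∈ Metric.closedBall (0 : En n) (2 * L) := by
    filter_upwards [hlx.eventually hT, hseg.eventually hT,
      hseg.eventually (Metric.closedBall_mem_nhds x0 one_pos)] with k h1 h2 h3
    have := hYmin (σ k) (p + (Y (σ k)).2 • v, (Y (σ k)).2) ⟨h3, (hYK (σ k)).2⟩
    simp only [add_sub_cancel_left, sub_self, norm_zero] at this
    have hl := hL.norm_sub_le h2 h1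
    have e : ‖p + (Y (σ k)).2 • v - (Y (σ k)).1‖ = ‖(Y (σ k)).1 - p - (Y (σ k)).2 • v‖ := by
      rw [norm_sub_rev, sub_sub]
    rw [e, Real.norm_eq_abs] at hl
    have h4 := le_abs_self (h (p + (Y (σ k)).2 • v) - h (Y (σ k)).1)
    rw [mem_closedBall_zero_iff]
    simp only [W, norm_smul, norm_neg, Real.norm_eq_abs]
    rw [abs_of_nonneg (by positivity)]
    set D := ‖(Y (σ k)).1 - p - (Y (σ k)).2 • v‖ with hDd
    have hD0 : 0 ≤ D := norm_nonneg _
    rcases eq_or_lt_of_le hD0 with h0 | h0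
    · rw [← h0]; simp
    · have : (σ k : ℝ) * D * D ≤ L * D := by nlinarith
      have := le_of_mul_le_mul_right this h0
      linarith
  obtain ⟨N, hN⟩ := eventually_atTop.1 (hbd.and (hsub.and hin))
  obtain ⟨z, -, ρ, hρ, hz⟩ := (isCompact_closedBall (0 : En n) (2 * L)).tendsto_subseq
    (x := fun k => W (k + N)) (fun k => (hN _ (Nat.le_add_left _ _)).1)
  have hτ : Tendsto (fun k => ρ k + N) atTop atTop :=
    (tendsto_add_atTop_nat N).comp hρ.tendsto_atTop
  refine ⟨tb, ht0, z, ⟨fun k => (Y (σ (ρ k + N))).1, fun k => W (ρ k + N), hlx.comp hτ, hz,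
    fun k => (hN _ (Nat.le_add_left _ _)).2.1⟩, ?_⟩
  have hl : Tendsto (fun k => c - 2 * ((Y (σ (ρ k + N))).2 - tb)) atTop (𝓝 (c - 2 * (tb - tb))) :=
    ((((hlt.comp hτ).sub_const tb).const_mul 2).const_sub c)
  have hr : Tendsto (fun k => ⟪W (ρ k + N), v⟫) atTop (𝓝 ⟪z, v⟫) := hz.inner tendsto_const_nhds
  have := le_of_tendsto_of_tendsto' hl hr fun k => (hN _ (Nat.le_add_left _ _)).2.2
  simpa using this

/-- second-order Taylor formula in the form of inequalities
for `C^{1,1}` functions, via the limiting second-order subdifferential. -/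
theorem stmt0 {n : ℕ} (φ : En n → ℝ) (hφ : IsC11 φ) (a b : En n) :
    ∃ ξ ∈ segment ℝ a b, ∃ ξ' ∈ segment ℝ a b,
      ∃ z ∈ secondSubdiff φ ξ (b - a), ∃ z' ∈ secondSubdiff φ ξ' (b - a),
        (1 / 2 : ℝ) * ⟪z', b - a⟫ ≤ φ b - φ a - ⟪gradient φ a, b - a⟫ ∧
        φ b - φ a - ⟪gradient φ a, b - a⟫ ≤ (1 / 2 : ℝ) * ⟪z, b - a⟫ := by
  obtain ⟨hd, hl⟩ := hφ
  set u := b - a with hu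
  set R := φ b - φ a - ⟪gradient φ a, u⟫ with hR
  have hh : LocallyLipschitz (fun x => ⟪u, gradient φ x⟫) :=
    ((innerSL ℝ u).lipschitz.locallyLipschitz).comp hl
  have hder : ∀ t : ℝ, HasDerivAt (fun t : ℝ => φ (a + t • u) - t * ⟪u, gradient φ a⟫ - t ^ 2 * R)
      (⟪u, gradient φ (a + t • u)⟫ - ⟪u, gradient φ a⟫ - 2 * t * R) t := by
    intro t
    have h1 := (hd (a + t • u)).hasGradientAt.hasFDerivAt
    have h2 : HasDerivAt (fun t : ℝ => a + t • u) u t := by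
      simpa using ((hasDerivAt_id t).smul_const u).const_add a
    have h3 := h1.comp_hasDerivAt t h2
    have h4 := (hasDerivAt_id t).mul_const ⟪u, gradient φ a⟫
    have h5 := (hasDerivAt_pow 2 t).mul_const R
    have h6 := (h3.sub h4).sub h5
    refine HasDerivAt.congr_deriv h6 ?_
    simp [real_inner_comm]
  have hfc : ContinuousOn (fun t : ℝ => φ (a + t • u) - t * ⟪u, gradient φ a⟫ - t ^ 2 * R)
      (Set.Icc 0 1) := fun t _ => (hder t).continuousAt.continuousWithinAt
  obtain ⟨s, hs, hs0⟩ := exists_hasDerivAt_eq_zero (zero_lt_one' ℝ)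
    (f := fun t : ℝ => φ (a + t • u) - t * ⟪u, gradient φ a⟫ - t ^ 2 * R)
    hfc (by
      have : a + u = b := by rw [hu]; abel
      simp only [zero_smul, one_smul, add_zero, this, hR, real_inner_comm u]; ring)
    (fun t _ => hder t)
  have hseg : ∀ t ∈ Set.Icc (0:ℝ) 1, a + t • u ∈ segment ℝ a b := by
    intro t ht
    rw [segment_eq_image']
    exact ⟨t, ht, rfl⟩
  obtain ⟨t, ht, z, hz, hzi⟩ := aux_mvt _ hh a (s • u)
  obtain ⟨t', ht', z', hz', hzi'⟩ := aux_mvt _ hh (a + s • u) (-(s • u))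
  rw [real_inner_smul_right] at hzi
  rw [inner_neg_right, real_inner_smul_right, add_neg_cancel_right] at hzi'
  have e1 : a + t • s • u = a + (t * s) • u := by rw [smul_smul]
  have e2 : a + s • u + t' • (-(s • u)) = a + (s - t' * s) • u := by
    rw [smul_neg, smul_smul, sub_smul]; abel
  rw [e1] at hz
  rw [e2] at hz'
  refine ⟨_, hseg (t * s) ⟨mul_nonneg ht.1 hs.1.le, ?_⟩, _, hseg (s - t' * s) ⟨?_, ?_⟩,
    z, hz, z', hz', ?_, ?_⟩
  · nlinarith [ht.1, ht.2, hs.1, hs.2]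
  · nlinarith [ht'.1, ht'.2, hs.1, hs.2]
  · nlinarith [ht'.1, ht'.2, hs.1, hs.2]
  · have : s * ⟪z', u⟫ ≤ s * (2 * R) := by linarith
    have := le_of_mul_le_mul_left this hs.1
    linarith
  · have : s * (2 * R) ≤ s * ⟪z, u⟫ := by linarith
    have := le_of_mul_le_mul_left this hs.1
    linarith
end
end

section
/- Let X := {x ∈ ℝⁿ : g_i(x) ≤ 0, i = 1, …, p}, where each g_i is of class C^{1,1}, let x̄ ∈ X and u ∈ ℝⁿ. Then T²(X; x̄, u) ⊂ L^{2−}(X; x̄, u); that is, for every v ∈ T²(X; x̄, u) and every i ∈ I(x̄), either ⟨∇g_i(x̄), u⟩ < 0, or ⟨∇g_i(x̄), u⟩ = 0 and ⟨∇g_i(x̄), v⟩ + min{⟨ζ, u⟩ : ζ ∈ ∂²g_i(x̄)(u)} ≤ 0. -/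
open Filter Topology RealInnerProductSpace

noncomputable section

lemma fs_iff {n : ℕ} [Nontrivial (En n)] {h : En n → ℝ} (hL : LocallyLipschitz h) (x v : En n) :
    v ∈ frechetSubdiff h x ↔
      ∀ ε > 0, ∀ᶠ y in 𝓝 x, -ε * ‖y - x‖ ≤ h y - h x - ⟪v, y - x⟫ := by
  obtain ⟨K, U, hU, hK⟩ := hL x
  have hb : ∀ᶠ y in 𝓝[≠] x, |(h y - h x - ⟪v, y - x⟫) / ‖y - x‖| ≤ K + ‖v‖ := by
    filter_upwards [self_mem_nhdsWithin, mem_nhdsWithin_of_mem_nhds hU] with y hy hyU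
    have hpos : 0 < ‖y - x‖ := norm_pos_iff.2 (sub_ne_zero.2 hy)
    rw [abs_div, abs_of_pos hpos, div_le_iff₀ hpos]
    have h1 := hK.dist_le_mul y hyU x (mem_of_mem_nhds hU)
    rw [Real.dist_eq, dist_eq_norm] at h1
    have h2 := abs_real_inner_le_norm v (y - x)
    have h3 := abs_sub (h y - h x) ⟪v, y - x⟫
    nlinarith
  have hbu : (𝓝[≠] x).IsBoundedUnder (· ≤ ·)
      (fun y => (h y - h x - ⟪v, y - x⟫) / ‖y - x‖) :=
    ⟨K + ‖v‖, by
      rw [eventually_map]; filter_upwards [hb] with y hy using (abs_le.1 hy).2⟩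
  have hbl : (𝓝[≠] x).IsBoundedUnder (· ≥ ·)
      (fun y => (h y - h x - ⟪v, y - x⟫) / ‖y - x‖) :=
    ⟨-(K + ‖v‖), by
      rw [eventually_map]; filter_upwards [hb] with y hy using (abs_le.1 hy).1⟩
  unfold frechetSubdiff
  rw [Set.mem_ofPred_eq, le_liminf_iff hbu.isCoboundedUnder_ge hbl]
  constructor
  · intro H ε hε
    have := H (-ε) (by linarith)
    rw [eventually_nhdsWithin_iff] at this
    filter_upwards [this] with y hy
    by_cases hyx : y = x
    · subst hyx; simp
    have hpos : 0 < ‖y - x‖ := norm_pos_iff.2 (sub_ne_zero.2 hyx)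
    have := hy hyx
    rw [lt_div_iff₀ hpos] at this
    exact this.le
  · intro H b hb
    have := H (-b/2) (by linarith)
    rw [eventually_nhdsWithin_iff]
    filter_upwards [this] with y hy hyx
    have hpos : 0 < ‖y - x‖ := norm_pos_iff.2 (sub_ne_zero.2 hyx)
    rw [lt_div_iff₀ hpos]
    nlinarith

lemma fs_norm_le {n : ℕ} [Nontrivial (En n)] {h : En n → ℝ} (hL : LocallyLipschitz h)
    {x v : En n} (hv : v ∈ frechetSubdiff h x) {K : NNReal} {U : Set (En n)} (hU : U ∈ 𝓝 x)
    (hK : LipschitzOnWith K h U) : ‖v‖ ≤ K := by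
  by_contra hlt
  push Not at hlt
  have hvp : 0 < ‖v‖ := lt_of_le_of_lt K.2 hlt
  have H := (fs_iff hL x v).1 hv ((‖v‖ - K) / 2) (by linarith)
  have H2 := H.and hU
  have ht : Tendsto (fun t : ℝ => x + t • v) (𝓝[>] 0) (𝓝 x) := by
    have : Tendsto (fun t : ℝ => x + t • v) (𝓝 0) (𝓝 (x + (0:ℝ) • v)) :=
      Continuous.tendsto (by fun_prop) 0
    rw [zero_smul, add_zero] at this
    exact this.mono_left nhdsWithin_le_nhds
  obtain ⟨t, ⟨h1, h2⟩, h3⟩ := ((ht.eventually H2).and self_mem_nhdsWithin).exists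
  have h3 : 0 < t := h3
  have h4 := hK.dist_le_mul _ h2 x (mem_of_mem_nhds hU)
  rw [Real.dist_eq, dist_eq_norm] at h4
  have h5 := le_abs_self (h (x + t • v) - h x)
  have h6 : x + t • v - x = t • v := by abel
  rw [h6, norm_smul, Real.norm_of_nonneg h3.le] at h4 h1
  rw [inner_smul_right, real_inner_self_eq_norm_sq] at h1
  have : 0 < t * ‖v‖ := by positivity
  nlinarith

lemma fs_of_min {n : ℕ} [Nontrivial (En n)] {h G : En n → ℝ} (hL : LocallyLipschitz h)
    {x w : En n} (hG : HasGradientAt G (-w) x) (hm : IsLocalMin (fun y => h y + G y) x) :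
    w ∈ frechetSubdiff h x := by
  rw [fs_iff hL]
  intro ε hε
  have h1 := (hasFDerivAt_iff_isLittleO.1 hG.hasFDerivAt).def hε
  filter_upwards [h1, hm] with y hy hmy
  simp only [InnerProductSpace.toDual_apply_apply, inner_neg_left] at hy
  rw [Real.norm_eq_abs] at hy
  have := (abs_le.1 hy).2
  linarith

lemma amvt {n : ℕ} [Nontrivial (En n)] {h : En n → ℝ} (hL : LocallyLipschitz h)
    (a u : En n) (hu : u ≠ 0) {s r R : ℝ} (hs : 0 < s) (hR : s * ‖u‖ < R)
    (hr : h (a + s • u) - h a < s * r) :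
    ∃ x ∈ Metric.ball a R, ∃ w ∈ frechetSubdiff h x, ⟪w, u⟫ ≤ r := by
  have hun : 0 < ‖u‖ := norm_pos_iff.2 hu
  have hc : Continuous h := hL.continuous
  let τ : En n → ℝ := fun x => ⟪u, x - a⟫ / ‖u‖ ^ 2
  have hτc : Continuous τ := by fun_prop
  have hτd : Differentiable ℝ τ := by
    have : Differentiable ℝ (fun x : En n => ⟪u, x - a⟫) :=
      (differentiable_const u).inner ℝ (differentiable_id.sub_const a)
    simp only [τ, div_eq_mul_inv]
    exact this.mul_const _
  have hτu : ∀ x (t : ℝ), τ (x + t • u) = τ x + t := by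
    intro x t
    have : x + t • u - a = (x - a) + t • u := by abel
    simp only [τ]
    rw [this, inner_add_right, inner_smul_right, real_inner_self_eq_norm_sq]
    field_simp
  have hτa : τ a = 0 := by simp [τ]
  let P : En n → ℝ := fun x => expNegInvGlue (τ x - s) + ‖x - a - τ x • u‖ ^ 2
  have hed : Differentiable ℝ expNegInvGlue :=
    (expNegInvGlue.contDiff (n := 1)).differentiable (by simp)
  have hPd : Differentiable ℝ P := by
    refine (hed.comp (hτd.sub_const s)).add ?_
    exact Differentiable.norm_sq ℝ ((differentiable_id.sub_const a).sub (hτd.smul_const u))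
  have hPc := hPd.continuous
  have hP0 : ∀ x, 0 ≤ P x := fun x => add_nonneg (expNegInvGlue.nonneg _) (by positivity)
  have hPu : ∀ x (t : ℝ), 0 ≤ t → P x ≤ P (x + t • u) := by
    intro x t ht
    have e : x + t • u - a - (τ x + t) • u = x - a - τ x • u := by
      rw [add_smul]; abel
    simp only [P, hτu, e]
    have : expNegInvGlue (τ x - s) ≤ expNegInvGlue (τ x + t - s) :=
      expNegInvGlue.monotone (by linarith)
    linarith
  let b := a + s • u
  have hτb : τ b = s := by rw [hτu, hτa, zero_add]
  have hPb : P b = 0 := by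
    simp only [P, hτb, sub_self, expNegInvGlue.zero, b, add_sub_cancel_left]
    simp
  have hPz : ∀ x, P x = 0 → 0 ≤ τ x → x = a + τ x • u ∧ ‖x - a‖ < R := by
    intro x hx h0
    have h1 : expNegInvGlue (τ x - s) = 0 ∧ ‖x - a - τ x • u‖ ^ 2 = 0 := by
      have q1 := expNegInvGlue.nonneg (τ x - s)
      have q2 : 0 ≤ ‖x - a - τ x • u‖ ^ 2 := by positivity
      simp only [P] at hx
      constructor <;> linarith
    have h2 := expNegInvGlue.zero_iff_nonpos.1 h1.1
    have h3 : x - a = τ x • u := by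
      have := h1.2
      rw [sq_eq_zero_iff, norm_eq_zero, sub_eq_zero] at this
      exact this
    refine ⟨by rw [← h3]; abel, ?_⟩
    rw [h3, norm_smul, Real.norm_of_nonneg h0]
    nlinarith
  let C : Set (En n) := Metric.closedBall a R ∩ {x | 0 ≤ τ x}
  have hC : IsCompact C :=
    (isCompact_closedBall a R).inter_right (isClosed_le continuous_const hτc)
  have hbC : b ∈ C := by
    refine ⟨?_, by simp only [Set.mem_ofPred_eq, hτb]; exact hs.le⟩
    simp only [Metric.mem_closedBall, b, dist_eq_norm, add_sub_cancel_left, norm_smul,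
      Real.norm_of_nonneg hs.le]
    exact hR.le
  have hex : ∀ k : ℕ, ∃ x ∈ C, IsMinOn (fun y => h y + (-r * τ y + k * P y)) C x := fun k =>
    hC.exists_isMinOn ⟨b, hbC⟩ (Continuous.continuousOn (by fun_prop))
  choose x hxC hxm using hex
  obtain ⟨xs, hxsC, φ, hφ, hlim⟩ := hC.tendsto_subseq hxC
  have hcmp : ∀ k, h (x k) + (-r * τ (x k) + k * P (x k)) ≤ h b - r * s := by
    intro k
    have := hxm k hbC
    simp only [Set.mem_ofPred_eq, hPb, hτb] at this
    linarith
  have hlim1 : Tendsto (fun k => h (x (φ k)) - r * τ (x (φ k))) atTop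
      (𝓝 (h xs - r * τ xs)) :=
    ((by fun_prop : Continuous fun y => h y - r * τ y).tendsto xs).comp hlim
  have hle : h xs - r * τ xs ≤ h b - r * s := by
    refine le_of_tendsto hlim1 (Eventually.of_forall fun k => ?_)
    have q := hcmp (φ k)
    have : 0 ≤ ((φ k : ℕ) : ℝ) * P (x (φ k)) := mul_nonneg (Nat.cast_nonneg _) (hP0 _)
    linarith
  have hPlim : Tendsto (fun k => P (x (φ k))) atTop (𝓝 (P xs)) := (hPc.tendsto xs).comp hlim
  have hPxs : P xs = 0 := by
    by_contra hne
    have hpos : 0 < P xs := lt_of_le_of_ne (hP0 _) (Ne.symm hne)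
    have h1 : Tendsto (fun k => ((φ k : ℕ) : ℝ) * P (x (φ k))) atTop atTop :=
      (tendsto_natCast_atTop_atTop.comp hφ.tendsto_atTop).atTop_mul_pos hpos hPlim
    have h2 := hlim1.add_atTop h1
    obtain ⟨k, hk⟩ := (h2.eventually_gt_atTop (h b - r * s)).exists
    have q := hcmp (φ k)
    linarith
  obtain ⟨hxs1, hxs2⟩ := hPz xs hPxs hxsC.2
  have hτxs : 0 < τ xs := by
    refine lt_of_le_of_ne hxsC.2 (fun h0 => ?_)
    rw [← h0, zero_smul, add_zero] at hxs1
    rw [← h0, hxs1] at hle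
    have : b = a + s • u := rfl
    rw [this] at hle
    linarith
  have hO : IsOpen (Metric.ball a R ∩ {y | 0 < τ y}) :=
    Metric.isOpen_ball.inter (isOpen_lt continuous_const hτc)
  have hxsO : xs ∈ Metric.ball a R ∩ {y | 0 < τ y} :=
    ⟨by rw [Metric.mem_ball, dist_eq_norm]; exact hxs2, hτxs⟩
  obtain ⟨k, hk⟩ := (hlim.eventually (hO.mem_nhds hxsO)).exists
  set z := x (φ k) with hz
  let G : En n → ℝ := fun y => -r * τ y + (φ k : ℕ) * P y
  have hGd : Differentiable ℝ G := (hτd.const_mul _).add (hPd.const_mul _)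
  have hmin : IsLocalMin (fun y => h y + G y) z := by
    filter_upwards [hO.mem_nhds hk] with y hy
    exact hxm (φ k) ⟨Metric.ball_subset_closedBall hy.1, (show 0 < τ y from hy.2).le⟩
  have hgr := (hGd z).hasGradientAt
  refine ⟨z, hk.1, -gradient G z, fs_of_min hL (by rwa [neg_neg]) hmin, ?_⟩
  have hline : HasDerivAt (fun t : ℝ => z + t • u) u 0 := by
    simpa using ((hasDerivAt_id (0:ℝ)).smul_const u).const_add z
  have hgr' : HasFDerivAt G (InnerProductSpace.toDual ℝ _ (gradient G z)) (z + (0:ℝ) • u) := by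
    rw [zero_smul, add_zero]; exact hgr.hasFDerivAt
  have hd := hgr'.comp_hasDerivAt (0:ℝ) hline
  rw [InnerProductSpace.toDual_apply_apply] at hd
  have hd2 := hd.add ((hasDerivAt_id (0:ℝ)).const_mul r)
  have h0 : 0 ≤ ⟪gradient G z, u⟫ + r * 1 := by
    refine ge_of_tendsto (hd2.tendsto_slope_zero_right) ?_
    filter_upwards [self_mem_nhdsWithin] with t ht
    have ht : 0 < t := ht
    have hp := hPu z t ht.le
    have : 0 ≤ ((φ k : ℕ) : ℝ) * (P (z + t • u) - P z) :=
      mul_nonneg (Nat.cast_nonneg _) (by linarith)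
    simp only [Pi.add_apply, Function.comp, G, zero_add, hτu, id, zero_smul, add_zero, smul_eq_mul]
    refine mul_nonneg (inv_nonneg.2 ht.le) ?_
    linarith
  rw [inner_neg_left]
  linarith

lemma lim_le {n : ℕ} [Nontrivial (En n)] {h : En n → ℝ} (hL : LocallyLipschitz h)
    (a u : En n) (hu : u ≠ 0) (ε : ℝ) (hε : 0 < ε) :
    ∀ᶠ s in 𝓝[>] (0:ℝ), s * (sInf ((fun ζ => ⟪ζ, u⟫) '' limitingSubdiff h a) - ε)
      ≤ h (a + s • u) - h a := by
  set m := sInf ((fun ζ => ⟪ζ, u⟫) '' limitingSubdiff h a) with hm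
  obtain ⟨K, U, hU, hK⟩ := hL a
  obtain ⟨ρ, hρ, hball⟩ := Metric.mem_nhds_iff.1 hU
  have hbd : ∀ x ∈ Metric.ball a ρ, ∀ w ∈ frechetSubdiff h x, ‖w‖ ≤ K := fun x hx w hw =>
    fs_norm_le hL hw (Metric.isOpen_ball.mem_nhds hx) (hK.mono hball)
  have hbb : BddBelow ((fun ζ => ⟪ζ, u⟫) '' limitingSubdiff h a) := by
    refine ⟨-(K * ‖u‖), ?_⟩
    rintro _ ⟨ζ, ⟨x, w, hx, hw, hk⟩, rfl⟩
    have h1 : ‖ζ‖ ≤ K := by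
      refine le_of_tendsto hw.norm ?_
      filter_upwards [hx.eventually (Metric.ball_mem_nhds a hρ)] with k hkk
      exact hbd _ hkk _ (hk k)
    have h2 := (abs_le.1 (abs_real_inner_le_norm ζ u)).1
    have := mul_le_mul_of_nonneg_right h1 (norm_nonneg u)
    show -(K * ‖u‖) ≤ ⟪ζ, u⟫
    linarith
  by_contra hcon
  rw [not_eventually] at hcon
  have hstep : ∀ k : ℕ, ∃ x w : En n, x ∈ Metric.ball a (min ρ (1 / (k + 1))) ∧
      w ∈ frechetSubdiff h x ∧ ⟪w, u⟫ ≤ m - ε := by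
    intro k
    have hR : 0 < min ρ (1 / ((k:ℝ) + 1)) := lt_min hρ (by positivity)
    have h1 : ∀ᶠ s in 𝓝[>] (0:ℝ), s * ‖u‖ < min ρ (1 / ((k:ℝ) + 1)) := by
      have : Tendsto (fun s : ℝ => s * ‖u‖) (𝓝 0) (𝓝 (0 * ‖u‖)) :=
        Continuous.tendsto (by fun_prop) 0
      rw [zero_mul] at this
      exact nhdsWithin_le_nhds (this.eventually (gt_mem_nhds hR))
    obtain ⟨s, ⟨h2, h3⟩, h4⟩ := ((hcon.and_eventually h1).and_eventually self_mem_nhdsWithin).exists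
    push Not at h2
    obtain ⟨x, hx, w, hw, hwu⟩ := amvt hL a u hu h4 h3 h2
    exact ⟨x, w, hx, hw, hwu⟩
  choose x w hx hw hwu using hstep
  have hxl : Tendsto x atTop (𝓝 a) := by
    rw [tendsto_iff_dist_tendsto_zero]
    refine squeeze_zero (fun _ => dist_nonneg) (fun k => ?_) tendsto_one_div_add_atTop_nhds_zero_nat
    exact ((Metric.mem_ball.1 (hx k)).trans_le (min_le_right _ _)).le
  have hwK : ∀ k, w k ∈ Metric.closedBall (0 : En n) K := fun k => by
    rw [mem_closedBall_zero_iff]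
    exact hbd _ (Metric.ball_subset_ball (min_le_left _ _) (hx k)) _ (hw k)
  obtain ⟨ζ, -, φ, hφ, hlim⟩ := (isCompact_closedBall (0 : En n) (K:ℝ)).tendsto_subseq hwK
  have hmem : ζ ∈ limitingSubdiff h a :=
    ⟨x ∘ φ, w ∘ φ, hxl.comp hφ.tendsto_atTop, hlim, fun k => hw _⟩
  have h1 : m ≤ ⟪ζ, u⟫ := csInf_le hbb ⟨ζ, hmem, rfl⟩
  have h2 : ⟪ζ, u⟫ ≤ m - ε :=
    le_of_tendsto (hlim.inner tendsto_const_nhds) (Eventually.of_forall fun k => hwu _)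
  linarith

lemma strict_lim {n : ℕ} {f : En n → ℝ} {f' : En n →L[ℝ] ℝ} {a d : En n}
    (hf : HasStrictFDerivAt f f' a) {x y : ℕ → En n} {c : ℕ → ℝ}
    (hx : Tendsto x atTop (𝓝 a)) (hy : Tendsto y atTop (𝓝 a))
    (hd : Tendsto (fun k => c k • (x k - y k)) atTop (𝓝 d)) :
    Tendsto (fun k => c k * (f (x k) - f (y k))) atTop (𝓝 (f' d)) := by
  have h1 := (hasStrictFDerivAt_iff_isLittleO.1 hf).comp_tendsto (hx.prodMk_nhds hy)
  have h2 := (Asymptotics.isBigO_refl c atTop).smul_isLittleO h1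
  have h3 := (h2.trans_isBigO (hd.isBigO_one ℝ)).tendsto_zero_of_tendsto tendsto_const_nhds
  have h4 := h3.add ((f'.continuous.tendsto d).comp hd)
  rw [zero_add] at h4
  refine h4.congr fun k => ?_
  simp [mul_sub]

/-- `T²(X; x̄, u) ⊆ L^{2−}(X; x̄, u)` for `C^{1,1}` inequality constraints. -/
theorem stmt5 {n p : ℕ} (g : Fin p → En n → ℝ) (hg : ∀ i, IsC11 (g i))
    (xb : En n) (hxb : ∀ i, g i xb ≤ 0) (u : En n)
    (v : En n) (hv : v ∈ secondTangent {x | ∀ i, g i x ≤ 0} xb u) :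
    ∀ i, g i xb = 0 →
      ⟪gradient (g i) xb, u⟫ < 0 ∨
      (⟪gradient (g i) xb, u⟫ = 0 ∧
        ⟪gradient (g i) xb, v⟫ + d2min (g i) xb u ≤ 0) := by
  obtain ⟨t, vk, ht, ht0, hvk, hmem⟩ := hv
  intro i hi
  obtain ⟨hd, hLg⟩ := hg i
  set f := g i with hf
  have hfd : ∀ y, HasFDerivAt f (InnerProductSpace.toDual ℝ _ (gradient f y)) y := fun y =>
    (hd y).hasGradientAt.hasFDerivAt
  have hst : HasStrictFDerivAt f (InnerProductSpace.toDual ℝ _ (gradient f xb)) xb := by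
    refine hasStrictFDerivAt_of_hasFDerivAt_of_continuousAt (Eventually.of_forall hfd) ?_
    exact ((InnerProductSpace.toDual ℝ (En n)).continuous.comp hLg.continuous).continuousAt
  set x : ℕ → En n := fun k => xb + t k • u + ((1 : ℝ) / 2 * (t k) ^ 2) • vk k with hx
  have hfx : ∀ k, f (x k) ≤ 0 := fun k => hmem k i
  have hyl : Tendsto (fun k => xb + t k • u) atTop (𝓝 xb) := by
    have := (ht0.smul_const u).const_add xb
    simpa using this
  have hxl : Tendsto x atTop (𝓝 xb) := by
    have := hyl.add (((ht0.pow 2).const_mul ((1:ℝ)/2)).smul hvk)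
    simpa [hx] using this
  have hd1 : Tendsto (fun k => (t k)⁻¹ • (x k - xb)) atTop (𝓝 u) := by
    have h1 := ((ht0.const_mul ((1:ℝ)/2)).smul hvk).const_add u
    simp only [mul_zero, zero_smul, add_zero] at h1
    refine h1.congr fun k => ?_
    have hne := (ht k).ne'
    have e : x k - xb = t k • (u + ((1:ℝ)/2 * t k) • vk k) := by
      simp only [hx]; module
    rw [e, inv_smul_smul₀ hne]
  have hl1 := strict_lim hst hxl tendsto_const_nhds hd1
  rw [InnerProductSpace.toDual_apply_apply] at hl1
  have hle : ⟪gradient f xb, u⟫ ≤ 0 := by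
    refine le_of_tendsto hl1 (Eventually.of_forall fun k => ?_)
    rw [hi, sub_zero]
    exact mul_nonpos_of_nonneg_of_nonpos (inv_nonneg.2 (ht k).le) (hfx k)
  rcases hle.lt_or_eq with hlt | heq
  · exact Or.inl hlt
  refine Or.inr ⟨heq, ?_⟩
  have hd2 : Tendsto (fun k => ((1 : ℝ) / 2 * (t k) ^ 2)⁻¹ • (x k - (xb + t k • u)))
      atTop (𝓝 v) := by
    refine hvk.congr fun k => ?_
    have hne : (1 : ℝ) / 2 * (t k) ^ 2 ≠ 0 := by have := ht k; positivity
    simp only [hx, add_sub_cancel_left]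
    rw [inv_smul_smul₀ hne]
  have hl2 := strict_lim hst hxl hyl hd2
  rw [InnerProductSpace.toDual_apply_apply] at hl2
  -- lower bound along the line
  have hkey : ∀ ε > 0, ∀ᶠ s in 𝓝[>] (0:ℝ), s * (d2min f xb u - ε) ≤ ⟪u, gradient f (xb + s • u)⟫ := by
    intro ε hε
    by_cases hu : u = 0
    · have hm : d2min f xb u = 0 := by
        unfold d2min
        rw [hu]
        simp only [inner_zero_right]
        rcases (secondSubdiff f xb 0).eq_empty_or_nonempty with h | h
        · rw [h]; simp
        · rw [h.image_const]; simp
      filter_upwards [self_mem_nhdsWithin] with s hs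
      have hs : 0 < s := hs
      rw [hm, hu, inner_zero_left]
      nlinarith
    · have : Nontrivial (En n) := ⟨u, 0, hu⟩
      have hLh : LocallyLipschitz (fun y => ⟪u, gradient f y⟫) :=
        ((innerSL ℝ u).lipschitz.locallyLipschitz).comp hLg
      filter_upwards [lim_le hLh xb u hu ε hε] with s hs
      rw [real_inner_comm (gradient f xb) u, heq, sub_zero] at hs
      exact hs
  refine le_of_forall_pos_le_add fun ε hε => ?_
  have hk := hkey ε hε
  obtain ⟨δ, hδ, hk⟩ := mem_nhdsGT_iff_exists_Ioo_subset.1 hk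
  have hδ : 0 < δ := hδ
  have hfin : ∀ᶠ k in atTop, ((1 : ℝ) / 2 * (t k) ^ 2)⁻¹ * (f (x k) - f (xb + t k • u))
      ≤ -(d2min f xb u - ε) := by
    filter_upwards [ht0.eventually (gt_mem_nhds hδ)] with k hkδ
    have htk := ht k
    have hder : ∀ s : ℝ, HasDerivAt (fun s : ℝ => f (xb + s • u))
        ⟪u, gradient f (xb + s • u)⟫ s := by
      intro s
      have hline : HasDerivAt (fun s : ℝ => xb + s • u) u s := by
        simpa using ((hasDerivAt_id s).smul_const u).const_add xb
      have := (hfd (xb + s • u)).comp_hasDerivAt s hline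
      rw [InnerProductSpace.toDual_apply_apply, real_inner_comm] at this
      exact this
    have hsq : ∀ s : ℝ, HasDerivAt (fun s : ℝ => (1:ℝ)/2 * s ^ 2) s s := by
      intro s
      have := (hasDerivAt_pow 2 s).const_mul ((1:ℝ)/2)
      refine this.congr_deriv ?_
      norm_num; ring
    obtain ⟨s, hs, hs2⟩ := exists_ratio_hasDerivAt_eq_ratio_slope
      (fun s : ℝ => f (xb + s • u)) (fun s => ⟪u, gradient f (xb + s • u)⟫) htk
      (fun s _ => (hder s).continuousAt.continuousWithinAt) (fun s _ => hder s)
      (fun s : ℝ => (1:ℝ)/2 * s ^ 2) (fun s => s)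
      (fun s _ => (hsq s).continuousAt.continuousWithinAt) (fun s _ => hsq s)
    have hb : s * (d2min f xb u - ε) ≤ ⟪u, gradient f (xb + s • u)⟫ :=
      hk ⟨hs.1, hs.2.trans hkδ⟩
    simp only [zero_smul, add_zero, hi, sub_zero] at hs2
    have hA : 0 < (1:ℝ)/2 * (t k)^2 := by positivity
    have h5 : (1:ℝ)/2 * (t k)^2 * (d2min f xb u - ε) ≤ f (xb + t k • u) := by
      have h6 := mul_le_mul_of_nonneg_left hb hA.le
      have h7 : s * ((1:ℝ)/2 * (t k)^2 * (d2min f xb u - ε)) ≤ s * f (xb + t k • u) := by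
        norm_num at hs2 h6 ⊢
        linarith
      exact le_of_mul_le_mul_left h7 hs.1
    rw [inv_mul_le_iff₀ hA]
    have := hfx k
    linarith
  have := le_of_tendsto hl2 hfin
  linarith
end
end

section
/- Let X := {x ∈ ℝⁿ : g_i(x) ≤ 0, i = 1, …, p}, where each g_i is of class C^{1,1}, let x̄ ∈ X and u ∈ ℝⁿ. Suppose there exists w ∈ ℝⁿ such that ⟨∇g_i(x̄), w⟩ + max{⟨ζ, u⟩ : ζ ∈ ∂²g_i(x̄)(u)} < 0 for every i ∈ I(x̄; u). Then the Abadie second-order constraint qualification holds at x̄ with respect to u, i.e., L²(X; x̄, u) ⊂ T²(X; x̄, u). -/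
open Filter Topology RealInnerProductSpace

noncomputable section

/-- The set `L²(X; x̄, u)` associated with the constraints `g_i ≤ 0`. -/
def L2set {n p : ℕ} (g : Fin p → En n → ℝ) (xb u : En n) : Set (En n) :=
  {v | ∀ i, g i xb = 0 →
      lexLe (⟪gradient (g i) xb, u⟫, ⟪gradient (g i) xb, v⟫ + d2max (g i) xb u) (0, 0)}

lemma aux_mem_frechet {n : ℕ} (h : En n → ℝ) (x v : En n) (C : ℝ) (hC : 0 ≤ C)
    (hev : ∀ᶠ z in 𝓝 x, -C * ‖z - x‖ ^ 2 ≤ h z - h x - ⟪v, z - x⟫) :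
    v ∈ frechetSubdiff h x := by
  show 0 ≤ Filter.liminf (fun y => (h y - h x - ⟪v, y - x⟫) / ‖y - x‖) (𝓝[≠] x)
  rw [Filter.liminf_eq]
  set S := {a : ℝ | ∀ᶠ y in 𝓝[≠] x, a ≤ (h y - h x - ⟪v, y - x⟫) / ‖y - x‖} with hS
  by_cases hb : BddAbove S
  · refine le_of_forall_pos_le_add fun ε hε => ?_
    have hmem : -ε ∈ S := by
      have h1 : ∀ᶠ z in 𝓝 x, C * ‖z - x‖ < ε := by
        have : Tendsto (fun z : En n => C * ‖z - x‖) (𝓝 x) (𝓝 (C * ‖x - x‖)) := by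
          apply Continuous.tendsto (f := fun z : En n => C * ‖z - x‖)
          fun_prop
        simp only [sub_self, norm_zero, mul_zero] at this
        exact this.eventually (gt_mem_nhds hε)
      have h2 : ∀ᶠ z in 𝓝[≠] x, z ≠ x := eventually_mem_nhdsWithin
      filter_upwards [h2, nhdsWithin_le_nhds h1, nhdsWithin_le_nhds hev] with z hz h1 h2
      have hp : 0 < ‖z - x‖ := norm_pos_iff.2 (sub_ne_zero.2 hz)
      rw [le_div_iff₀ hp]
      nlinarith
    linarith [le_csSup hb hmem]
  · rw [Real.sSup_of_not_bddAbove hb]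

lemma aux_frechet_bdd {n : ℕ} (h : En n → ℝ) (x v : En n) (L : ℝ) (hL : 0 ≤ L)
    (hev : ∀ᶠ z in 𝓝 x, |h z - h x| ≤ L * ‖z - x‖)
    (hv : v ∈ frechetSubdiff h x) : ‖v‖ ≤ L := by
  by_contra hlt
  push Not at hlt
  change 0 ≤ Filter.liminf (fun y => (h y - h x - ⟪v, y - x⟫) / ‖y - x‖) (𝓝[≠] x) at hv
  rw [Filter.liminf_eq] at hv
  set S := {a : ℝ | ∀ᶠ y in 𝓝[≠] x, a ≤ (h y - h x - ⟪v, y - x⟫) / ‖y - x‖} with hS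
  have hvpos : 0 < ‖v‖ := lt_of_le_of_lt hL hlt
  have hne : S.Nonempty := by
    refine ⟨-L - ‖v‖, ?_⟩
    have h2 : ∀ᶠ z in 𝓝[≠] x, z ≠ x := eventually_mem_nhdsWithin
    filter_upwards [h2, nhdsWithin_le_nhds hev] with z hz h1
    have hp : 0 < ‖z - x‖ := norm_pos_iff.2 (sub_ne_zero.2 hz)
    rw [le_div_iff₀ hp]
    have := (abs_le.1 h1).1
    have := real_inner_le_norm v (z - x)
    nlinarith
  have hub : ∀ a ∈ S, a ≤ L - ‖v‖ := by
    intro a ha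
    have ht : Tendsto (fun t : ℝ => x + t • v) (𝓝[>] 0) (𝓝[≠] x) := by
      apply tendsto_nhdsWithin_of_tendsto_nhds_of_eventually_within
      · have : Tendsto (fun t : ℝ => x + t • v) (𝓝 0) (𝓝 (x + (0:ℝ) • v)) := by
          apply Continuous.tendsto (f := fun t : ℝ => x + t • v)
          fun_prop
        simp only [zero_smul, add_zero] at this
        exact this.mono_left nhdsWithin_le_nhds
      · filter_upwards [self_mem_nhdsWithin] with t ht
        have ht : 0 < t := ht
        simp [ht.ne', norm_pos_iff.1 hvpos]
    have e1 := ht.eventually ha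
    have e2 := ht.eventually (nhdsWithin_le_nhds hev)
    obtain ⟨t, ⟨h1, h2⟩, ht⟩ := ((e1.and e2).and self_mem_nhdsWithin).exists
    have ht : 0 < t := ht
    simp only [add_sub_cancel_left, norm_smul, Real.norm_eq_abs, abs_of_pos ht,
      inner_smul_right, real_inner_self_eq_norm_sq] at h1 h2
    have hp : 0 < t * ‖v‖ := by positivity
    rw [le_div_iff₀ hp] at h1
    have := (abs_le.1 h2).2
    have : a * (t * ‖v‖) ≤ (L - ‖v‖) * (t * ‖v‖) := by nlinarith
    exact le_of_mul_le_mul_right this hp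
  have := csSup_le hne hub
  linarith

/-- A mean value inequality. -/
lemma aux_mvi {n : ℕ} (h : En n → ℝ) (xb u : En n) (L r c s : ℝ) (hL : 0 ≤ L) (hr : 0 < r)
    (hs : 0 ≤ s) (hsu : s * ‖u‖ ≤ r / 2)
    (hlip : ∀ x ∈ Metric.closedBall xb r, ∀ y ∈ Metric.closedBall xb r,
      |h x - h y| ≤ L * ‖x - y‖)
    (hc : ∀ x ∈ Metric.ball xb r, ∀ ζ ∈ frechetSubdiff h x, ⟪ζ, u⟫ ≤ c) :
    h (xb + s • u) - h xb ≤ c * s := by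
  by_contra hcon
  push Not at hcon
  have hs0 : 0 < s := by
    rcases hs.eq_or_lt with h0 | h0
    · subst h0; simp at hcon
    · exact h0
  obtain ⟨γ, hγpos, hγ⟩ : ∃ γ > 0, c * s + 2 * γ < h (xb + s • u) - h xb :=
    ⟨(h (xb + s • u) - h xb - c * s) / 4, by linarith, by linarith⟩
  set c' := c + γ / s with hc'
  have hc's : c' * s = c * s + γ := by rw [hc']; field_simp
  have hcc : c < c' := by rw [hc']; linarith [div_pos hγpos hs0]
  -- choose K
  obtain ⟨K, hKpos, hK1, hK2⟩ : ∃ K : ℝ, 0 < K ∧ L < K * (r / 2) ∧ L ^ 2 ≤ 4 * K * γ := by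
    refine ⟨max (L / (r / 2) + 1) (L ^ 2 / (4 * γ)), ?_, ?_, ?_⟩
    · exact lt_of_lt_of_le (by positivity) (le_max_left _ _)
    · have := le_max_left (L / (r / 2) + 1) (L ^ 2 / (4 * γ))
      have h3 : L / (r / 2) < max (L / (r / 2) + 1) (L ^ 2 / (4 * γ)) := by linarith
      rwa [div_lt_iff₀ (by positivity)] at h3
    · have := le_max_right (L / (r / 2) + 1) (L ^ 2 / (4 * γ))
      rw [div_le_iff₀ (by positivity)] at this
      linarith
  have hcont : ContinuousOn h (Metric.closedBall xb r) := by
    have : LipschitzOnWith L.toNNReal h (Metric.closedBall xb r) := by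
      apply LipschitzOnWith.of_dist_le_mul
      intro x hx y hy
      rw [Real.dist_eq, dist_eq_norm, Real.coe_toNNReal _ hL]
      exact hlip x hx y hy
    exact this.continuousOn
  set F : ℝ × En n → ℝ := fun q => h q.2 + K * ‖q.2 - xb - q.1 • u‖ ^ 2 - c' * q.1 with hF
  have hcomp : IsCompact (Set.Icc (0:ℝ) s ×ˢ Metric.closedBall xb r) :=
    isCompact_Icc.prod (isCompact_closedBall xb r)
  have hFc : ContinuousOn F (Set.Icc (0:ℝ) s ×ˢ Metric.closedBall xb r) := by
    have h1 : ContinuousOn (fun q : ℝ × En n => h q.2) (Set.Icc (0:ℝ) s ×ˢ Metric.closedBall xb r) :=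
      hcont.comp continuousOn_snd (fun q hq => hq.2)
    have h2 : Continuous (fun q : ℝ × En n => K * ‖q.2 - xb - q.1 • u‖ ^ 2) := by fun_prop
    have h3 : Continuous (fun q : ℝ × En n => c' * q.1) := by fun_prop
    exact (h1.add h2.continuousOn).sub h3.continuousOn
  obtain ⟨⟨τ, y⟩, ⟨hτ, hy⟩, hmin⟩ := hcomp.exists_isMinOn
    ⟨(0, xb), ⟨⟨le_rfl, hs⟩, Metric.mem_closedBall_self hr.le⟩⟩ hFc
  have hmin' : ∀ σ ∈ Set.Icc (0:ℝ) s, ∀ z ∈ Metric.closedBall xb r,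
      h y + K * ‖y - xb - τ • u‖ ^ 2 - c' * τ ≤ h z + K * ‖z - xb - σ • u‖ ^ 2 - c' * σ :=
    fun σ hσ z hz => hmin (show (σ, z) ∈ _ from ⟨hσ, hz⟩)
  simp only at hτ hy
  have hseg : ∀ σ ∈ Set.Icc (0:ℝ) s, ‖σ • u‖ ≤ r / 2 := by
    intro σ hσ
    rw [norm_smul, Real.norm_eq_abs, abs_of_nonneg hσ.1]
    exact (mul_le_mul_of_nonneg_right hσ.2 (norm_nonneg u)).trans hsu
  have hsegm : ∀ σ ∈ Set.Icc (0:ℝ) s, xb + σ • u ∈ Metric.closedBall xb r := by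
    intro σ hσ
    rw [mem_closedBall_iff_norm, add_sub_cancel_left]
    linarith [hseg σ hσ]
  set e := y - xb - τ • u with he
  have hey : y - (xb + τ • u) = e := by rw [he]; abel
  have hlipe : |h y - h (xb + τ • u)| ≤ L * ‖e‖ := by
    rw [← hey]; exact hlip y hy _ (hsegm τ hτ)
  -- interiority
  have hKe : K * ‖e‖ ^ 2 ≤ L * ‖e‖ := by
    have := hmin' τ hτ _ (hsegm τ hτ)
    simp only [add_sub_cancel_left, sub_self, norm_zero] at this
    have := (abs_le.1 hlipe).1
    nlinarith
  have heb : ‖e‖ < r / 2 := by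
    by_contra hge
    push Not at hge
    have : 0 < ‖e‖ := by linarith
    have : K * ‖e‖ ≤ L := by
      have h5 : (K * ‖e‖) * ‖e‖ ≤ L * ‖e‖ := by nlinarith
      exact le_of_mul_le_mul_right h5 this
    nlinarith
  have hyb : y ∈ Metric.ball xb r := by
    rw [mem_ball_iff_norm]
    have : y - xb = e + τ • u := by rw [he]; abel
    rw [this]
    have := norm_add_le e (τ • u)
    linarith [hseg τ hτ]
  have hτs : τ < s := by
    refine lt_of_le_of_ne hτ.2 ?_
    intro h0
    have h1 := hmin' 0 ⟨le_rfl, hs⟩ xb (Metric.mem_closedBall_self hr.le)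
    simp only [sub_self, zero_smul, norm_zero] at h1
    rw [h0] at hlipe h1
    have h2 := (abs_le.1 hlipe).1
    have h3 : 0 ≤ (2 * K * ‖e‖ - L) ^ 2 := sq_nonneg _
    have h4 : 4 * K * (L * ‖e‖ - K * ‖e‖ ^ 2) ≤ 4 * K * γ := by nlinarith
    have h5 := le_of_mul_le_mul_left h4 (by positivity)
    nlinarith
  have hζ : (-(2 * K)) • e ∈ frechetSubdiff h y := by
    apply aux_mem_frechet h y _ K hKpos.le
    filter_upwards [Metric.isOpen_ball.mem_nhds hyb] with z hz
    have h1 := hmin' τ hτ z (Metric.ball_subset_closedBall hz)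
    have h2 : z - xb - τ • u = e + (z - y) := by rw [he]; abel
    rw [h2, norm_add_sq_real] at h1
    rw [inner_smul_left]
    simp only [conj_trivial]
    nlinarith
  have h1 := hc y hyb _ hζ
  rw [inner_smul_left] at h1
  simp only [conj_trivial] at h1
  -- derivative in τ
  have hder : ∀ δ ∈ Set.Ioo (0:ℝ) (s - τ), c' ≤ -(2 * K) * ⟪e, u⟫ + K * δ * ‖u‖ ^ 2 := by
    intro δ hδ
    have h2 := hmin' (τ + δ) ⟨by linarith [hτ.1, hδ.1], by linarith [hδ.2]⟩ y hy
    have h3 : y - xb - (τ + δ) • u = e - δ • u := by rw [he, add_smul]; abel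
    rw [h3, norm_sub_sq_real e (δ • u), inner_smul_right, norm_smul, Real.norm_eq_abs,
      abs_of_pos hδ.1] at h2
    have h4 : c' * δ ≤ (-(2 * K) * ⟪e, u⟫ + K * δ * ‖u‖ ^ 2) * δ := by nlinarith
    exact le_of_mul_le_mul_right h4 hδ.1
  have hlim : Tendsto (fun δ : ℝ => -(2 * K) * ⟪e, u⟫ + K * δ * ‖u‖ ^ 2) (𝓝[>] 0)
      (𝓝 (-(2 * K) * ⟪e, u⟫)) := by
    have : Tendsto (fun δ : ℝ => -(2 * K) * ⟪e, u⟫ + K * δ * ‖u‖ ^ 2) (𝓝 0)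
      (𝓝 (-(2 * K) * ⟪e, u⟫ + K * 0 * ‖u‖ ^ 2)) := by
      apply Continuous.tendsto (f := fun δ : ℝ => -(2 * K) * ⟪e, u⟫ + K * δ * ‖u‖ ^ 2)
      fun_prop
    simp only [mul_zero, zero_mul, add_zero] at this
    exact this.mono_left nhdsWithin_le_nhds
  have := ge_of_tendsto hlim (b := c') (by
    filter_upwards [Ioo_mem_nhdsGT (show (0:ℝ) < s - τ by linarith)] with δ hδ
    exact hder δ hδ)
  linarith

/-- Local boundedness of subgradients by the maximum. -/
lemma aux_usc {n : ℕ} (h : En n → ℝ) (xb u : En n) (L r ε : ℝ) (hL : 0 ≤ L) (hr : 0 < r)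
    (hε : 0 < ε)
    (hlip : ∀ x ∈ Metric.closedBall xb r, ∀ y ∈ Metric.closedBall xb r,
      |h x - h y| ≤ L * ‖x - y‖) :
    ∃ δ > 0, δ ≤ r ∧ ∀ x ∈ Metric.ball xb δ, ∀ ζ ∈ frechetSubdiff h x,
      ⟪ζ, u⟫ ≤ sSup ((fun ζ => ⟪ζ, u⟫) '' limitingSubdiff h xb) + ε := by
  have hb : ∀ x ∈ Metric.ball xb r, ∀ ζ ∈ frechetSubdiff h x, ‖ζ‖ ≤ L := by
    intro x hx ζ hζ
    apply aux_frechet_bdd h x ζ L hL _ hζ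
    filter_upwards [Metric.isOpen_ball.mem_nhds hx] with z hz
    exact hlip z (Metric.ball_subset_closedBall hz) x (Metric.ball_subset_closedBall hx)
  have hbdd : BddAbove ((fun ζ => ⟪ζ, u⟫) '' limitingSubdiff h xb) := by
    refine ⟨L * ‖u‖, ?_⟩
    rintro _ ⟨ζ, ⟨x, w, hx, hw, hk⟩, rfl⟩
    have : ‖ζ‖ ≤ L := by
      apply le_of_tendsto hw.norm
      filter_upwards [hx.eventually (Metric.ball_mem_nhds xb hr)] with k hk'
      exact hb _ hk' _ (hk k)
    exact (real_inner_le_norm ζ u).trans (mul_le_mul_of_nonneg_right this (norm_nonneg u))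
  by_contra hcon
  push Not at hcon
  have hpos : ∀ k : ℕ, 0 < min r (1 / ((k:ℝ) + 1)) := fun k => lt_min hr (by positivity)
  choose x hx ζ hζ hlt using fun k : ℕ => hcon _ (hpos k) (min_le_left _ _)
  have hxt : Tendsto x atTop (𝓝 xb) := by
    rw [tendsto_iff_dist_tendsto_zero]
    refine squeeze_zero (fun _ => dist_nonneg) (fun k => ?_) tendsto_one_div_add_atTop_nhds_zero_nat
    exact (Metric.mem_ball.1 (hx k)).le.trans (min_le_right _ _)
  have hζb : ∀ k, ζ k ∈ Metric.closedBall (0 : En n) L := by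
    intro k
    rw [mem_closedBall_zero_iff]
    exact hb _ (Metric.ball_subset_ball (min_le_left _ _) (hx k)) _ (hζ k)
  obtain ⟨z, -, φ, hφ, hz⟩ := (isCompact_closedBall (0 : En n) L).tendsto_subseq hζb
  have hmem : z ∈ limitingSubdiff h xb :=
    ⟨x ∘ φ, ζ ∘ φ, hxt.comp hφ.tendsto_atTop, hz, fun k => hζ _⟩
  have h1 := le_csSup hbdd ⟨z, hmem, rfl⟩
  have h2 : Tendsto (fun k => ⟪(ζ ∘ φ) k, u⟫) atTop (𝓝 ⟪z, u⟫) := hz.inner tendsto_const_nhds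
  have h3 := ge_of_tendsto' h2 (fun k => (hlt (φ k)).le)
  simp only at h1
  linarith

lemma aux_lip {n : ℕ} (φ : En n → ℝ) (hφ : IsC11 φ) (xb u : En n) :
    ∃ L r : ℝ, 0 ≤ L ∧ 0 < r ∧ ∀ x ∈ Metric.closedBall xb r, ∀ y ∈ Metric.closedBall xb r,
      |⟪u, gradient φ x⟫ - ⟪u, gradient φ y⟫| ≤ L * ‖x - y‖ := by
  obtain ⟨K, t, ht, hK⟩ := hφ.2 xb
  obtain ⟨r, hr, hrt⟩ := Metric.nhds_basis_closedBall.mem_iff.1 ht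
  refine ⟨‖u‖ * K, r, by positivity, hr, fun x hx y hy => ?_⟩
  rw [← inner_sub_right]
  have h1 := hK.dist_le_mul x (hrt hx) y (hrt hy)
  rw [dist_eq_norm, dist_eq_norm] at h1
  calc _ ≤ ‖u‖ * ‖gradient φ x - gradient φ y‖ := abs_real_inner_le_norm _ _
    _ ≤ ‖u‖ * (K * ‖x - y‖) := by gcongr
    _ = _ := by ring

lemma aux_second {n : ℕ} (φ : En n → ℝ) (hφ : IsC11 φ) (xb u : En n) (ε : ℝ) (hε : 0 < ε) :
    ∀ᶠ t in 𝓝[>] (0:ℝ), φ (xb + t • u) ≤ φ xb + t * ⟪gradient φ xb, u⟫ +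
      (d2max φ xb u + ε) * (t ^ 2 / 2) := by
  obtain ⟨L, r, hL, hr, hlip⟩ := aux_lip φ hφ xb u
  obtain ⟨δ, hδ, hδr, hc⟩ := aux_usc (fun x => ⟪u, gradient φ x⟫) xb u L r ε hL hr hε hlip
  set c := d2max φ xb u + ε with hcdef
  have hT : 0 < δ / 2 / (‖u‖ + 1) := by positivity
  filter_upwards [Ioo_mem_nhdsGT hT] with t ht
  have hmv : ∀ s ∈ Set.Icc (0:ℝ) t, ⟪u, gradient φ (xb + s • u)⟫ - ⟪u, gradient φ xb⟫ ≤ c * s := by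
    intro s hs
    refine aux_mvi (fun x => ⟪u, gradient φ x⟫) xb u L δ c s hL hδ hs.1 ?_
      (fun x hx y hy => hlip x (Metric.closedBall_subset_closedBall hδr hx) y
        (Metric.closedBall_subset_closedBall hδr hy)) hc
    have h1 : s < δ / 2 / (‖u‖ + 1) := lt_of_le_of_lt hs.2 ht.2
    rw [lt_div_iff₀ (by positivity)] at h1
    nlinarith [hs.1]
  have hd : ∀ s : ℝ, HasDerivAt (fun s : ℝ => φ (xb + s • u) - s * ⟪u, gradient φ xb⟫ - c * (s ^ 2 / 2))
      (⟪u, gradient φ (xb + s • u)⟫ - ⟪u, gradient φ xb⟫ - c * s) s := by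
    intro s
    have h1 := (hφ.1 (xb + s • u)).hasGradientAt.hasFDerivAt
    have h2 : HasDerivAt (fun s : ℝ => xb + s • u) u s := by
      simpa using ((hasDerivAt_id s).smul_const u).const_add xb
    have h3 := h1.comp_hasDerivAt s h2
    rw [InnerProductSpace.toDual_apply_apply, real_inner_comm] at h3
    have h4 : HasDerivAt (fun s : ℝ => s * ⟪u, gradient φ xb⟫) ⟪u, gradient φ xb⟫ s := by
      simpa using (hasDerivAt_id s).mul_const ⟪u, gradient φ xb⟫
    have h5 : HasDerivAt (fun s : ℝ => c * (s ^ 2 / 2)) (c * s) s := by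
      have := ((hasDerivAt_pow 2 s).div_const 2).const_mul c
      exact this.congr_deriv (by norm_num)
    exact (h3.sub h4).sub h5
  have hanti : AntitoneOn (fun s : ℝ => φ (xb + s • u) - s * ⟪u, gradient φ xb⟫ - c * (s ^ 2 / 2))
      (Set.Icc 0 t) := by
    apply antitoneOn_of_deriv_nonpos (convex_Icc 0 t)
    · exact fun s _ => (hd s).continuousAt.continuousWithinAt
    · exact fun s _ => (hd s).differentiableAt.differentiableWithinAt
    · intro s hs
      rw [(hd s).deriv]
      have := hmv s (interior_subset hs)
      linarith
  have := hanti (Set.left_mem_Icc.2 ht.1.le) (Set.right_mem_Icc.2 ht.1.le) ht.1.le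
  simp only [zero_smul, add_zero, zero_mul] at this
  rw [real_inner_comm]
  have e0 : c * ((0:ℝ) ^ 2 / 2) = 0 := by ring
  rw [e0] at this
  linarith

lemma aux_curve {n : ℕ} (xb u v : En n) :
    Tendsto (fun t : ℝ => xb + t • u + ((1 : ℝ) / 2 * t ^ 2) • v) (𝓝[>] 0) (𝓝 xb) := by
  have : Tendsto (fun t : ℝ => xb + t • u + ((1 : ℝ) / 2 * t ^ 2) • v) (𝓝 0)
      (𝓝 (xb + (0:ℝ) • u + ((1 : ℝ) / 2 * 0 ^ 2) • v)) := by
    apply Continuous.tendsto (f := fun t : ℝ => xb + t • u + ((1 : ℝ) / 2 * t ^ 2) • v)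
    fun_prop
  simp only [zero_smul, add_zero, ne_eq, OfNat.ofNat_ne_zero, not_false_eq_true, zero_pow,
    mul_zero] at this
  exact this.mono_left nhdsWithin_le_nhds

lemma aux_feas_second {n : ℕ} (φ : En n → ℝ) (hφ : IsC11 φ) (xb u v : En n) (h0 : φ xb = 0)
    (h1 : ⟪gradient φ xb, u⟫ = 0) (h2 : ⟪gradient φ xb, v⟫ + d2max φ xb u < 0) :
    ∀ᶠ t in 𝓝[>] (0:ℝ), φ (xb + t • u + ((1 : ℝ) / 2 * t ^ 2) • v) ≤ 0 := by
  set ε := -(⟪gradient φ xb, v⟫ + d2max φ xb u) / 2 with hε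
  have hεp : 0 < ε := by rw [hε]; linarith
  have hstrict : HasStrictFDerivAt φ (InnerProductSpace.toDual ℝ (En n) (gradient φ xb)) xb := by
    apply hasStrictFDerivAt_of_hasFDerivAt_of_continuousAt
      (f' := fun x => InnerProductSpace.toDual ℝ (En n) (gradient φ x))
    · exact Eventually.of_forall fun x => (hφ.1 x).hasGradientAt.hasFDerivAt
    · exact ((InnerProductSpace.toDual ℝ (En n)).continuous.comp hφ.2.continuous).continuousAt
  have hη : 0 < ε / (‖v‖ + 1) := by positivity
  have hlo := (hasStrictFDerivAt_iff_isLittleO.1 hstrict).def hη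
  have hc1 := aux_curve xb u v
  have hc2 : Tendsto (fun t : ℝ => xb + t • u) (𝓝[>] 0) (𝓝 xb) := by
    simpa using aux_curve xb u 0
  have hlo' := (hc1.prodMk_nhds hc2).eventually hlo
  filter_upwards [hlo', aux_second φ hφ xb u ε hεp, self_mem_nhdsWithin] with t ht1 ht2 ht
  have ht : 0 < t := ht
  simp only [add_sub_cancel_left, InnerProductSpace.toDual_apply_apply, inner_smul_right,
    norm_smul] at ht1
  rw [Real.norm_eq_abs, Real.norm_eq_abs, abs_of_pos (show 0 < 1 / 2 * t ^ 2 by positivity)] at ht1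
  have h3 := (abs_le.1 ht1).2
  rw [h0, h1] at ht2
  have h4 : ε / (‖v‖ + 1) * ‖v‖ ≤ ε := by
    rw [div_mul_eq_mul_div, div_le_iff₀ (by positivity)]
    nlinarith
  have h5 : ε / (‖v‖ + 1) * (1 / 2 * t ^ 2 * ‖v‖) ≤ ε * (1 / 2 * t ^ 2) := by
    have : 0 < 1 / 2 * t ^ 2 := by positivity
    nlinarith
  have h6 : (⟪gradient φ xb, v⟫ + d2max φ xb u) = - 2 * ε := by rw [hε]; ring
  nlinarith

lemma aux_feas_first {n : ℕ} (φ : En n → ℝ) (hφ : IsC11 φ) (xb u v : En n) (h0 : φ xb = 0)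
    (h1 : ⟪gradient φ xb, u⟫ < 0) :
    ∀ᶠ t in 𝓝[>] (0:ℝ), φ (xb + t • u + ((1 : ℝ) / 2 * t ^ 2) • v) ≤ 0 := by
  have hd : HasDerivAt (fun t : ℝ => xb + t • u + ((1 : ℝ) / 2 * t ^ 2) • v) u 0 := by
    have h2 : HasDerivAt (fun s : ℝ => xb + s • u) u 0 := by
      simpa using ((hasDerivAt_id (0:ℝ)).smul_const u).const_add xb
    have h3 : HasDerivAt (fun s : ℝ => ((1 : ℝ) / 2 * s ^ 2) • v) 0 0 := by
      simpa using (((hasDerivAt_pow 2 (0:ℝ)).const_mul (1/2 : ℝ)).smul_const v)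
    have h4 := h2.add h3
    rw [add_zero] at h4
    exact h4
  have hg : HasFDerivAt φ (InnerProductSpace.toDual ℝ (En n) (gradient φ xb))
      ((fun t : ℝ => xb + t • u + ((1 : ℝ) / 2 * t ^ 2) • v) 0) := by
    simpa using (hφ.1 xb).hasGradientAt.hasFDerivAt
  have hcomp := hg.comp_hasDerivAt (0:ℝ) hd
  rw [InnerProductSpace.toDual_apply_apply] at hcomp
  have hsl := hcomp.hasDerivWithinAt (s := Set.Ioi 0)
  rw [hasDerivWithinAt_iff_tendsto_slope' (by simp)] at hsl
  filter_upwards [hsl.eventually (gt_mem_nhds h1), self_mem_nhdsWithin] with t ht1 ht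
  have ht : 0 < t := ht
  rw [slope_def_field, sub_zero, div_lt_iff₀ ht] at ht1
  simp [h0] at ht1
  simpa using ht1.le

/-- a sufficient condition for the Abadie second-order constraint
qualification `L²(X; x̄, u) ⊆ T²(X; x̄, u)`. -/
theorem stmt6 {n p : ℕ} (g : Fin p → En n → ℝ) (hg : ∀ i, IsC11 (g i))
    (xb : En n) (hxb : ∀ i, g i xb ≤ 0) (u : En n)
    (hw : ∃ w : En n, ∀ i, g i xb = 0 → ⟪gradient (g i) xb, u⟫ = 0 →
        ⟪gradient (g i) xb, w⟫ + d2max (g i) xb u < 0) :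
    L2set g xb u ⊆ secondTangent {x | ∀ i, g i x ≤ 0} xb u := by
  obtain ⟨w, hw⟩ := hw
  intro v hv
  have hs : ∀ k : ℕ, (0:ℝ) < 1 / ((k:ℝ) + 1) ∧ (1:ℝ) / ((k:ℝ) + 1) ≤ 1 := by
    intro k
    refine ⟨by positivity, ?_⟩
    rw [div_le_one (by positivity)]
    linarith [Nat.cast_nonneg (α := ℝ) k]
  set vk : ℕ → En n := fun k => v + ((1:ℝ) / ((k:ℝ) + 1)) • (w - v) with hvk
  have hev : ∀ k, ∀ᶠ t in 𝓝[>] (0:ℝ), ∀ i, g i (xb + t • u + ((1 : ℝ) / 2 * t ^ 2) • vk k) ≤ 0 := by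
    intro k
    rw [eventually_all]
    intro i
    rcases (hxb i).lt_or_eq with hlt | h0
    · have := ((hg i).1.continuous.tendsto xb).comp (aux_curve xb u (vk k))
      filter_upwards [this.eventually (gt_mem_nhds hlt)] with t ht using le_of_lt ht
    · rcases hv i h0 with h1 | ⟨h1, h2⟩
      · exact aux_feas_first (g i) (hg i) xb u _ h0 h1
      · apply aux_feas_second (g i) (hg i) xb u _ h0 h1
        have h3 := hw i h0 h1
        simp only at h2
        obtain ⟨hs1, hs2⟩ := hs k
        simp only [hvk, inner_add_right, inner_smul_right, inner_sub_right]
        nlinarith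
  have hex : ∀ k : ℕ, ∃ t : ℝ, (0 < t ∧ t < 1 / ((k:ℝ) + 1)) ∧
      ∀ i, g i (xb + t • u + ((1 : ℝ) / 2 * t ^ 2) • vk k) ≤ 0 := by
    intro k
    obtain ⟨t, h1, h2⟩ := ((hev k).and (Ioo_mem_nhdsGT (hs k).1)).exists
    exact ⟨t, h2, h1⟩
  choose t ht hfe using hex
  refine ⟨t, vk, fun k => (ht k).1, ?_, ?_, hfe⟩
  · exact squeeze_zero (fun k => (ht k).1.le) (fun k => (ht k).2.le)
      tendsto_one_div_add_atTop_nhds_zero_nat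
  · have := (tendsto_one_div_add_atTop_nhds_zero_nat (𝕜 := ℝ)).smul_const (w - v)
    simpa [hvk] using this.const_add v
end
end

section
/- Consider the problem (VOP) with feasible set X := {x ∈ ℝⁿ : g_i(x) ≤ 0, i = 1, …, p} and C^{1,1} data. Let x̄ be a local weak efficient solution of (VOP) and suppose the Abadie second-order constraint qualification holds at x̄ with respect to every critical direction at x̄. Then there is no pair (u, v) ∈ ℝⁿ × ℝⁿ such that (⟨∇f_l(x̄), u⟩, ⟨∇f_l(x̄), v⟩ + max{⟨ξ, u⟩ : ξ ∈ ∂²f_l(x̄)(u)}) <_lex (0, 0) for all l = 1, …, m and (⟨∇g_i(x̄), u⟩, ⟨∇g_i(x̄), v⟩ + max{⟨ζ, u⟩ : ζ ∈ ∂²g_i(x̄)(u)}) ≤_lex (0, 0) for all i ∈ I(x̄). -/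
open Filter Topology RealInnerProductSpace

noncomputable section

/-- `u` is a critical direction of (VOP) at `x̄`. -/
def IsCriticalDir {n m p : ℕ} (f : Fin m → En n → ℝ) (g : Fin p → En n → ℝ)
    (xb u : En n) : Prop :=
  (∀ l, ⟪gradient (f l) xb, u⟫ ≤ 0) ∧ (∃ l, ⟪gradient (f l) xb, u⟫ = 0) ∧
    (∀ i, g i xb = 0 → ⟪gradient (g i) xb, u⟫ ≤ 0)

lemma quot_abs {n : ℕ} {h : En n → ℝ} {L : ℝ} {y z w : En n} (hL0 : 0 ≤ L)
    (hL : |h z - h y| ≤ L * ‖z - y‖) :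
    |(h z - h y - ⟪w, z - y⟫) / ‖z - y‖| ≤ L + ‖w‖ := by
  rw [abs_div, abs_norm]
  have h1 := abs_real_inner_le_norm w (z - y)
  have h2 := abs_sub (h z - h y) ⟪w, z - y⟫
  refine div_le_of_le_mul₀ (norm_nonneg _) (by positivity) ?_
  nlinarith

lemma mem_frechet {n : ℕ} {h : En n → ℝ} {L N : ℝ} {y w : En n} (hL0 : 0 ≤ L) (hN : 0 ≤ N)
    (hL : ∀ᶠ z in 𝓝 y, |h z - h y| ≤ L * ‖z - y‖)
    (hq : ∀ᶠ z in 𝓝 y, -(N * ‖z - y‖ ^ 2) ≤ h z - h y - ⟪w, z - y⟫) :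
    w ∈ frechetSubdiff h y := by
  change 0 ≤ Filter.liminf (fun z => (h z - h y - ⟪w, z - y⟫) / ‖z - y‖) (𝓝[≠] y)
  rcases eq_or_neBot (𝓝[≠] y) with hb | hb
  · rw [hb]; simp [Filter.liminf_eq]
  have hcob : IsCoboundedUnder (· ≥ ·) (𝓝[≠] y)
      (fun z => (h z - h y - ⟪w, z - y⟫) / ‖z - y‖) := by
    apply Filter.IsBoundedUnder.isCoboundedUnder_ge
    refine ⟨L + ‖w‖, ?_⟩
    rw [eventually_map]
    filter_upwards [hL.filter_mono nhdsWithin_le_nhds] with z hz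
    exact (abs_le.1 (quot_abs hL0 hz)).2
  refine le_of_forall_pos_lt_add fun ε hε => ?_
  have : -(ε/2) ≤ Filter.liminf (fun z => (h z - h y - ⟪w, z - y⟫) / ‖z - y‖) (𝓝[≠] y) := by
    refine le_liminf_of_le hcob ?_
    have hball : ∀ᶠ z in 𝓝 y, ‖z - y‖ < ε / (2 * (N + 1)) := by
      have := Metric.ball_mem_nhds y (show 0 < ε / (2 * (N + 1)) by positivity)
      filter_upwards [this] with z hz
      rwa [mem_ball_iff_norm] at hz
    filter_upwards [hq.filter_mono nhdsWithin_le_nhds, hball.filter_mono nhdsWithin_le_nhds,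
      self_mem_nhdsWithin] with z h1 h2 h3
    have h4 : 0 < ‖z - y‖ := norm_pos_iff.2 (sub_ne_zero.2 h3)
    rw [le_div_iff₀ h4]
    rw [lt_div_iff₀ (by positivity)] at h2
    nlinarith
  linarith

lemma frechet_bound {n : ℕ} {h : En n → ℝ} {L : ℝ} {y w : En n} (hL0 : 0 ≤ L)
    (hL : ∀ᶠ z in 𝓝 y, |h z - h y| ≤ L * ‖z - y‖)
    (hw : w ∈ frechetSubdiff h y) : ‖w‖ ≤ L := by
  rcases eq_or_ne w 0 with rfl | hw0
  · simpa using hL0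
  have hwp : 0 < ‖w‖ := norm_pos_iff.2 hw0
  refine le_of_forall_pos_le_add fun ε hε => ?_
  have hbd : IsBoundedUnder (· ≥ ·) (𝓝[≠] y)
      (fun z => (h z - h y - ⟪w, z - y⟫) / ‖z - y‖) := by
    refine ⟨-(L + ‖w‖), ?_⟩
    rw [eventually_map]
    filter_upwards [hL.filter_mono nhdsWithin_le_nhds] with z hz
    exact (abs_le.1 (quot_abs hL0 hz)).1
  have hw' : 0 ≤ Filter.liminf (fun z => (h z - h y - ⟪w, z - y⟫) / ‖z - y‖) (𝓝[≠] y) := hw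
  have hev := eventually_lt_of_lt_liminf (b := -ε) (lt_of_lt_of_le (by linarith) hw') hbd
  have ht : Tendsto (fun t : ℝ => y + t • w) (𝓝[>] 0) (𝓝[≠] y) := by
    refine tendsto_nhdsWithin_iff.2 ⟨?_, ?_⟩
    · have : Tendsto (fun t : ℝ => y + t • w) (𝓝 0) (𝓝 (y + (0:ℝ) • w)) :=
        Continuous.tendsto (by fun_prop) 0
      simp only [zero_smul, add_zero] at this
      exact this.mono_left nhdsWithin_le_nhds
    · filter_upwards [self_mem_nhdsWithin] with t ht
      have : t ≠ 0 := ne_of_gt ht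
      simp [this, hw0]
  obtain ⟨t, ht1, ht2, ht3⟩ := ((ht.eventually hev).and
    ((ht.eventually (hL.filter_mono nhdsWithin_le_nhds)).and self_mem_nhdsWithin)).exists
  have ht0 : (0:ℝ) < t := ht3
  simp only [add_sub_cancel_left, norm_smul, Real.norm_eq_abs, abs_of_pos ht0,
    real_inner_smul_right, real_inner_self_eq_norm_sq] at ht1 ht2
  rw [lt_div_iff₀ (by positivity)] at ht1
  have h5 := (abs_le.1 ht2).2
  have h6 : (t * ‖w‖) * ‖w‖ ≤ (t * ‖w‖) * (L + ε) := by nlinarith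
  exact le_of_mul_le_mul_left h6 (by positivity)

lemma key_mvt {n : ℕ} {h : En n → ℝ} {L R c s : ℝ} {a u : En n} (hL0 : 0 ≤ L)
    (hL : ∀ x ∈ Metric.closedBall a R, ∀ y ∈ Metric.closedBall a R, |h x - h y| ≤ L * ‖x - y‖)
    (hs : 0 < s) (hsR : s * ‖u‖ < R) (hc : c * s < h (a + s • u) - h a) :
    ∃ y ∈ Metric.ball a R, ∃ w ∈ frechetSubdiff h y, c ≤ ⟪w, u⟫ := by
  have hu := norm_nonneg u
  have hR : 0 < R := lt_of_le_of_lt (by positivity) hsR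
  set η := h (a + s • u) - h a - c * s with hη
  have hη0 : 0 < η := by linarith
  set r := R - s * ‖u‖ with hr
  have hr0 : 0 < r := by linarith
  obtain ⟨N, hN0, hN1, hN2⟩ : ∃ N : ℝ, 0 < N ∧ L < N * r ∧ L ^ 2 < N * η := by
    refine ⟨L / r + L ^ 2 / η + 1, by positivity, ?_, ?_⟩
    · have : (L / r + L ^ 2 / η + 1) * r = L + L ^ 2 / η * r + r := by field_simp
      have : 0 ≤ L ^ 2 / η * r := by positivity
      linarith
    · have : (L / r + L ^ 2 / η + 1) * η = L / r * η + L ^ 2 + η := by field_simp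
      have : 0 ≤ L / r * η := by positivity
      linarith
  have hcont : ContinuousOn h (Metric.closedBall a R) := by
    have : LipschitzOnWith (Real.toNNReal L) h (Metric.closedBall a R) := by
      refine LipschitzOnWith.of_dist_le_mul fun x hx y hy => ?_
      rw [Real.dist_eq, dist_eq_norm, Real.coe_toNNReal _ hL0]
      exact hL x hx y hy
    exact this.continuousOn
  have hcpt : IsCompact (Metric.closedBall a R ×ˢ Set.Icc (0:ℝ) s) :=
    (isCompact_closedBall a R).prod isCompact_Icc
  obtain ⟨⟨y, τ⟩, ⟨hy, hτ⟩, hmin⟩ := hcpt.exists_isMinOn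
    (f := fun q : En n × ℝ => h q.1 - c * q.2 + N * ‖q.1 - (a + q.2 • u)‖ ^ 2)
    ⟨(a, 0), by simp [hR.le], by simp [hs.le]⟩ (by
      have h1 : ContinuousOn (fun q : En n × ℝ => h q.1)
          (Metric.closedBall a R ×ˢ Set.Icc (0:ℝ) s) :=
        hcont.comp continuousOn_fst (fun q hq => hq.1)
      have h2 : Continuous (fun q : En n × ℝ => N * ‖q.1 - (a + q.2 • u)‖ ^ 2) := by fun_prop
      have h3 : Continuous (fun q : En n × ℝ => c * q.2) := by fun_prop
      exact (h1.sub h3.continuousOn).add h2.continuousOn)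
  have hmin' : ∀ z ∈ Metric.closedBall a R, ∀ σ ∈ Set.Icc (0:ℝ) s,
      h y - c * τ + N * ‖y - (a + τ • u)‖ ^ 2 ≤ h z - c * σ + N * ‖z - (a + σ • u)‖ ^ 2 :=
    fun z hz σ hσ => hmin (Set.mk_mem_prod hz hσ)
  simp only at hy hτ
  have hτ0 := hτ.1
  have hτs := hτ.2
  have hpm : ∀ σ ∈ Set.Icc (0:ℝ) s, a + σ • u ∈ Metric.closedBall a R := by
    intro σ hσ
    rw [mem_closedBall_iff_norm, add_sub_cancel_left, norm_smul, Real.norm_eq_abs,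
      abs_of_nonneg hσ.1]
    nlinarith [hσ.2]
  set p := a + τ • u with hp
  have hpB := hpm τ hτ
  set d := ‖y - p‖ with hd
  have hd0 : 0 ≤ d := norm_nonneg _
  have hNd : N * d ≤ L := by
    have h1 := hmin' p hpB τ hτ
    rw [← hp, sub_self, norm_zero] at h1
    have h2 := hL y hy p hpB
    have h3 := (abs_le.1 h2).1
    rcases hd0.eq_or_lt with h0 | h0
    · rw [← h0]; simpa using hL0
    · have : d * (N * d) ≤ d * L := by nlinarith
      exact le_of_mul_le_mul_left this h0
  have hyb : y ∈ Metric.ball a R := by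
    rw [mem_ball_iff_norm]
    have h1 : ‖y - a‖ ≤ d + τ * ‖u‖ := by
      have : y - a = (y - p) + τ • u := by rw [hp]; abel
      rw [this]
      refine (norm_add_le _ _).trans ?_
      rw [norm_smul, Real.norm_eq_abs, abs_of_nonneg hτ0]
    have h2 : d < r := by
      by_contra hcon
      push Not at hcon
      nlinarith
    nlinarith
  have hτlt : τ < s := by
    refine lt_of_le_of_ne hτs fun he => ?_
    have h1 := hmin' a (by simp [hR.le]) 0 (by simp [hs.le])
    simp only [zero_smul, add_zero, sub_self, norm_zero] at h1
    have h2 := (abs_le.1 (hL y hy p hpB)).1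
    have h3 : h p = h (a + s • u) := by rw [hp, he]
    have h4 : η ≤ L * d - N * d ^ 2 := by rw [hη, ← h3]; rw [he] at h1; linarith
    nlinarith [sq_nonneg (N * d), mul_nonneg hN0.le hd0]
  have hnb : Metric.closedBall a R ∈ 𝓝 y :=
    mem_of_superset (Metric.isOpen_ball.mem_nhds hyb) Metric.ball_subset_closedBall
  refine ⟨y, hyb, (-(2 * N)) • (y - p), ?_, ?_⟩
  · refine mem_frechet (L := L) (N := N) hL0 hN0.le ?_ ?_
    · filter_upwards [hnb] with z hz using hL z hz y hy
    · filter_upwards [hnb] with z hz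
      have h1 := hmin' z hz τ hτ
      rw [← hp] at h1
      have h2 : z - p = (y - p) + (z - y) := by abel
      rw [h2, norm_add_sq_real] at h1
      rw [real_inner_smul_left]
      nlinarith
  · rw [real_inner_smul_left]
    refine le_of_forall_pos_le_add fun ε hε => ?_
    set e := min (s - τ) (ε / (N * ‖u‖ ^ 2 + 1)) with he
    have he0 : 0 < e := lt_min (by linarith) (by positivity)
    have he1 : e ≤ s - τ := min_le_left _ _
    have he2 : e * (N * ‖u‖ ^ 2 + 1) ≤ ε := by
      rw [← le_div_iff₀ (by positivity)]; exact min_le_right _ _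
    have h1 := hmin' y hy (τ + e) ⟨by linarith, by linarith⟩
    have h2 : y - (a + (τ + e) • u) = (y - p) - e • u := by rw [hp, add_smul]; abel
    rw [h2, norm_sub_sq_real (y - p) (e • u), real_inner_smul_right, norm_smul, Real.norm_eq_abs,
      abs_of_pos he0] at h1
    have h3 : e * c ≤ e * (-(2 * N) * ⟪y - p, u⟫ + N * e * ‖u‖ ^ 2) := by nlinarith
    have h4 := le_of_mul_le_mul_left h3 he0
    nlinarith

lemma loc_lip {n : ℕ} {φ : En n → ℝ} (hφ : IsC11 φ) (xb u : En n) :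
    ∃ L R : ℝ, 0 ≤ L ∧ 0 < R ∧ ∀ x ∈ Metric.closedBall xb R, ∀ y ∈ Metric.closedBall xb R,
      |⟪u, gradient φ x⟫ - ⟪u, gradient φ y⟫| ≤ L * ‖x - y‖ := by
  obtain ⟨K, t, ht, hK⟩ := hφ.2 xb
  obtain ⟨R, hR, hRt⟩ := Metric.nhds_basis_closedBall.mem_iff.1 ht
  refine ⟨‖u‖ * K, R, by positivity, hR, fun x hx y hy => ?_⟩
  rw [← inner_sub_right]
  refine (abs_real_inner_le_norm _ _).trans ?_
  rw [mul_assoc]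
  exact mul_le_mul_of_nonneg_left (hK.norm_sub_le (hRt hx) (hRt hy)) (norm_nonneg _)

lemma slope_bound {n : ℕ} {φ : En n → ℝ} (hφ : IsC11 φ) (xb u : En n) {c : ℝ}
    (hc : d2max φ xb u < c) :
    ∃ δ > 0, ∀ s : ℝ, 0 < s → s < δ →
      ⟪u, gradient φ (xb + s • u)⟫ - ⟪u, gradient φ xb⟫ ≤ c * s := by
  obtain ⟨L, R, hL0, hR, hL⟩ := loc_lip hφ xb u
  set h : En n → ℝ := fun x => ⟪u, gradient φ x⟫ with hh
  have hbd : ∀ y ∈ Metric.ball xb R, ∀ w ∈ frechetSubdiff h y, ‖w‖ ≤ L := by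
    intro y hy w hw
    refine frechet_bound hL0 ?_ hw
    filter_upwards [Metric.isOpen_ball.mem_nhds hy] with z hz
    exact hL z (Metric.ball_subset_closedBall hz) y (Metric.ball_subset_closedBall hy)
  have hbdd : BddAbove ((fun ζ => ⟪ζ, u⟫) '' secondSubdiff φ xb u) := by
    refine ⟨L * ‖u‖, ?_⟩
    rintro _ ⟨ζ, ⟨x, w, hx, hw, hxw⟩, rfl⟩
    have h1 : ‖ζ‖ ≤ L := by
      refine le_of_tendsto hw.norm ?_
      filter_upwards [hx.eventually (Metric.ball_mem_nhds xb hR)] with k hk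
      exact hbd _ hk _ (hxw k)
    exact (real_inner_le_norm _ _).trans (mul_le_mul_of_nonneg_right h1 (norm_nonneg _))
  by_contra hcon
  push Not at hcon
  have hex : ∀ k : ℕ, ∃ y w : En n, y ∈ Metric.ball xb (R / (k + 1)) ∧
      w ∈ frechetSubdiff h y ∧ c ≤ ⟪w, u⟫ := by
    intro k
    have hk : (0:ℝ) < k + 1 := by positivity
    have hRk : 0 < R / (k + 1) := by positivity
    obtain ⟨s, hs0, hs1, hs2⟩ := hcon (R / (k + 1) / (‖u‖ + 1)) (by positivity)
    have hsub : Metric.closedBall xb (R / (k + 1)) ⊆ Metric.closedBall xb R :=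
      Metric.closedBall_subset_closedBall (div_le_self hR.le (by linarith [k.cast_nonneg (α := ℝ)]))
    obtain ⟨y, hy, w, hw, hcw⟩ := key_mvt (h := h) (R := R / (k + 1)) (u := u) (s := s) (c := c)
      hL0 (fun x hx y hy => hL x (hsub hx) y (hsub hy)) hs0 (by
        rw [lt_div_iff₀ (by positivity)] at hs1
        linarith) hs2
    exact ⟨y, w, hy, hw, hcw⟩
  choose y w hy hw hcw using hex
  have hyR : ∀ k, y k ∈ Metric.ball xb R := fun k =>
    Metric.ball_subset_ball (div_le_self hR.le (by linarith [k.cast_nonneg (α := ℝ)])) (hy k)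
  have hyt : Tendsto y atTop (𝓝 xb) := by
    rw [tendsto_iff_dist_tendsto_zero]
    have h0 : Tendsto (fun k : ℕ => R / ((k : ℝ) + 1)) atTop (𝓝 0) := by
      have := (tendsto_one_div_add_atTop_nhds_zero_nat (𝕜 := ℝ)).const_mul R
      simpa [div_eq_mul_inv] using this
    exact squeeze_zero (fun _ => dist_nonneg) (fun k => (Metric.mem_ball.1 (hy k)).le) h0
  obtain ⟨ζ, -, ψ, hψ, hζ⟩ := tendsto_subseq_of_bounded
    (Metric.isBounded_closedBall (x := (0 : En n)) (r := L)) (x := w)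
    (fun k => by simpa using hbd _ (hyR k) _ (hw k))
  have hmem : ζ ∈ secondSubdiff φ xb u :=
    ⟨y ∘ ψ, w ∘ ψ, hyt.comp hψ.tendsto_atTop, hζ, fun k => hw (ψ k)⟩
  have h1 : ⟪ζ, u⟫ ≤ d2max φ xb u := le_csSup hbdd ⟨ζ, hmem, rfl⟩
  have h2 : c ≤ ⟪ζ, u⟫ :=
    ge_of_tendsto (hζ.inner tendsto_const_nhds) (Eventually.of_forall fun k => hcw (ψ k))
  linarith

lemma hasFD {n : ℕ} {φ : En n → ℝ} (hφ : IsC11 φ) (x : En n) :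
    HasFDerivAt φ (InnerProductSpace.toDual ℝ (En n) (gradient φ x)) x :=
  (hφ.1 x).hasGradientAt.hasFDerivAt

lemma taylor_line {n : ℕ} {φ : En n → ℝ} (hφ : IsC11 φ) (xb u : En n) {c : ℝ}
    (hc : d2max φ xb u < c) :
    ∃ δ > 0, ∀ t : ℝ, 0 < t → t < δ →
      φ (xb + t • u) - φ xb - t * ⟪gradient φ xb, u⟫ ≤ c * t ^ 2 / 2 := by
  obtain ⟨δ, hδ, hs⟩ := slope_bound hφ xb u hc
  refine ⟨δ, hδ, fun t ht0 htδ => ?_⟩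
  set θ : ℝ → ℝ := fun s => φ (xb + s • u) - s * ⟪gradient φ xb, u⟫ - c * s ^ 2 / 2 with hθ
  have hder : ∀ s, HasDerivAt θ
      (⟪gradient φ (xb + s • u), u⟫ - ⟪gradient φ xb, u⟫ - c * s) s := by
    intro s
    have h1 : HasDerivAt (fun s : ℝ => xb + s • u) u s := by
      simpa using ((hasDerivAt_id s).smul_const u).const_add xb
    have h2 := (hasFD hφ (xb + s • u)).comp_hasDerivAt s h1
    rw [InnerProductSpace.toDual_apply_apply] at h2
    have h3 := (h2.sub ((hasDerivAt_id s).mul_const ⟪gradient φ xb, u⟫)).sub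
      ((((hasDerivAt_id s).pow 2).const_mul c).div_const 2)
    refine (h3.congr_deriv ?_)
    simp
    ring
  have hanti : AntitoneOn θ (Set.Icc 0 t) := by
    refine antitoneOn_of_deriv_nonpos (convex_Icc 0 t)
      (fun s _ => (hder s).continuousAt.continuousWithinAt)
      (fun s _ => (hder s).differentiableAt.differentiableWithinAt) fun s hsi => ?_
    rw [interior_Icc] at hsi
    rw [(hder s).deriv]
    have := hs s hsi.1 (hsi.2.trans htδ)
    rw [real_inner_comm _ u, real_inner_comm _ u] at this
    linarith
  have := hanti (Set.left_mem_Icc.2 ht0.le) (Set.right_mem_Icc.2 ht0.le) ht0.le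
  simp only [hθ, zero_smul, add_zero, zero_mul] at this
  linarith

lemma first_order {n : ℕ} {φ : En n → ℝ} (hφ : IsC11 φ) {xb u : En n}
    (hu : ⟪gradient φ xb, u⟫ < 0) {t : ℕ → ℝ} {d : ℕ → En n} (ht : ∀ k, 0 < t k)
    (ht0 : Tendsto t atTop (𝓝 0)) (hd : Tendsto d atTop (𝓝 u)) :
    ∀ᶠ k in atTop, φ (xb + t k • d k) < φ xb := by
  have h1 := (hasFD hφ xb).hasFDerivWithinAt (s := Set.univ)
  have h2 := h1.lim (c := fun k => (t k)⁻¹) (d := fun k => t k • d k) (v := u) (l := atTop)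
    (by simpa using ht0.smul hd) (by simp)
    (hd.congr fun k => by rw [inv_smul_smul₀ (ht k).ne'])
  rw [InnerProductSpace.toDual_apply_apply] at h2
  filter_upwards [h2.eventually (gt_mem_nhds hu)] with k hk
  rw [smul_eq_mul] at hk
  have := ht k
  have h3 : 0 < (t k)⁻¹ := inv_pos.2 this
  by_contra hcon
  push Not at hcon
  exact absurd hk (not_lt.2 (mul_nonneg h3.le (by linarith)))

lemma second_order {n : ℕ} {φ : En n → ℝ} (hφ : IsC11 φ) {xb u v : En n}
    (hu : ⟪gradient φ xb, u⟫ = 0) (hv : ⟪gradient φ xb, v⟫ + d2max φ xb u < 0)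
    {t : ℕ → ℝ} {d : ℕ → En n} (ht : ∀ k, 0 < t k)
    (ht0 : Tendsto t atTop (𝓝 0)) (hd : Tendsto d atTop (𝓝 v)) :
    ∀ᶠ k in atTop, φ (xb + t k • u + ((1 : ℝ) / 2 * (t k) ^ 2) • d k) < φ xb := by
  obtain ⟨c, hc1, hc2⟩ := exists_between (show d2max φ xb u < -⟪gradient φ xb, v⟫ by linarith)
  obtain ⟨δ, hδ, hT⟩ := taylor_line hφ xb u hc1
  have hstrict : HasStrictFDerivAt φ (InnerProductSpace.toDual ℝ (En n) (gradient φ xb)) xb :=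
    hasStrictFDerivAt_of_hasFDerivAt_of_continuousAt
      (f' := fun x => InnerProductSpace.toDual ℝ (En n) (gradient φ x))
      (Eventually.of_forall (hasFD hφ))
      ((InnerProductSpace.toDual ℝ (En n)).continuous.comp hφ.2.continuous).continuousAt
  have hlo := hasStrictFDerivAt_iff_isLittleO.1 hstrict
  have hy : Tendsto (fun k => xb + t k • u) atTop (𝓝 xb) := by
    simpa using (ht0.smul_const u).const_add xb
  have hx : Tendsto (fun k => xb + t k • u + ((1 : ℝ) / 2 * (t k) ^ 2) • d k) atTop (𝓝 xb) := by
    simpa using hy.add (((ht0.pow 2).const_mul ((1:ℝ)/2)).smul hd)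
  have hpair := hx.prodMk_nhds hy
  have hin : Tendsto (fun k => ⟪gradient φ xb, d k⟫) atTop (𝓝 ⟪gradient φ xb, v⟫) :=
    tendsto_const_nhds.inner hd
  set γ := -⟪gradient φ xb, v⟫ - c with hγ
  have hγ0 : 0 < γ := by linarith
  have hev := hpair.eventually
    (Asymptotics.isLittleO_iff.1 hlo (show 0 < γ / (4 * (‖v‖ + 1)) by positivity))
  filter_upwards [hev, ht0.eventually (gt_mem_nhds hδ),
    hd.norm.eventually (gt_mem_nhds (show ‖v‖ < ‖v‖ + 1 by linarith)),
    hin.eventually (gt_mem_nhds (show ⟪gradient φ xb, v⟫ < ⟪gradient φ xb, v⟫ + γ / 4 by linarith))]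
    with k h1 h2 h3 h4
  have htk := ht k
  have h5 := hT (t k) htk h2
  simp only [add_sub_cancel_left, InnerProductSpace.toDual_apply_apply, real_inner_smul_right,
    norm_smul] at h1
  have h6 := (abs_le.1 h1).2
  rw [Real.norm_eq_abs, abs_of_pos (show 0 < 1 / 2 * t k ^ 2 by positivity)] at h6
  rw [hu] at h5
  have h7 : γ / (4 * (‖v‖ + 1)) * (1 / 2 * t k ^ 2 * ‖d k‖) ≤ (1 / 2 * t k ^ 2) * (γ / 4) := by
    have : γ / (4 * (‖v‖ + 1)) * ‖d k‖ ≤ γ / 4 := by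
      rw [div_mul_eq_mul_div, div_le_div_iff₀ (by positivity) (by positivity)]
      nlinarith
    calc _ = (1 / 2 * t k ^ 2) * (γ / (4 * (‖v‖ + 1)) * ‖d k‖) := by ring
      _ ≤ _ := mul_le_mul_of_nonneg_left this (by positivity)
  have h8 : (1 / 2 * t k ^ 2) * (c + ⟪gradient φ xb, d k⟫ + γ / 4) < 0 :=
    mul_neg_of_pos_of_neg (by positivity) (by linarith)
  nlinarith

lemma d2max_zero {n : ℕ} (φ : En n → ℝ) (xb : En n) : d2max φ xb 0 = 0 := by
  unfold d2max
  rcases (secondSubdiff φ xb 0).eq_empty_or_nonempty with h | h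
  · simp [h]
  · simp [h.image_const]

/-- primal second-order necessary condition for a local weak efficient
solution under the Abadie second-order constraint qualification. -/
theorem stmt8 {n m p : ℕ} (f : Fin m → En n → ℝ) (g : Fin p → En n → ℝ)
    (hf : ∀ l, IsC11 (f l)) (hg : ∀ i, IsC11 (g i))
    (xb : En n) (hxb : ∀ i, g i xb ≤ 0)
    (hweak : ∃ U ∈ 𝓝 xb, ∀ x ∈ U, (∀ i, g i x ≤ 0) → ¬ (∀ l, f l x < f l xb))
    (hASCQ : ∀ u : En n, IsCriticalDir f g xb u →
        L2set g xb u ⊆ secondTangent {x | ∀ i, g i x ≤ 0} xb u) :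
    ¬ ∃ u v : En n,
        (∀ l, lexLt (⟪gradient (f l) xb, u⟫,
            ⟪gradient (f l) xb, v⟫ + d2max (f l) xb u) (0, 0)) ∧
        (∀ i, g i xb = 0 → lexLe (⟪gradient (g i) xb, u⟫,
            ⟪gradient (g i) xb, v⟫ + d2max (g i) xb u) (0, 0)) := by
  rintro ⟨u, v, hfu, hgu⟩
  obtain ⟨U, hU, hw⟩ := hweak
  have hne : Nonempty (Fin m) := by
    by_contra hcon
    rw [not_nonempty_iff] at hcon
    exact hw xb (mem_of_mem_nhds hU) hxb (fun l => (hcon.false l).elim)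
  have hfu0 : ∀ l, ⟪gradient (f l) xb, u⟫ ≤ 0 := fun l => by
    rcases hfu l with h | h
    · exact h.le
    · exact h.1.le
  have hgu0 : ∀ i, g i xb = 0 → ⟪gradient (g i) xb, u⟫ ≤ 0 := fun i hi => by
    rcases hgu i hi with h | h
    · exact h.le
    · exact h.1.le
  by_cases hcr : ∃ l, ⟪gradient (f l) xb, u⟫ = 0
  · obtain ⟨t, d, ht, ht0, hd, hX⟩ := hASCQ u ⟨hfu0, hcr, hgu0⟩ (show v ∈ L2set g xb u from hgu)
    have hx : Tendsto (fun k => xb + t k • u + ((1 : ℝ) / 2 * (t k) ^ 2) • d k) atTop (𝓝 xb) := by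
      have hy : Tendsto (fun k => xb + t k • u) atTop (𝓝 xb) := by
        simpa using (ht0.smul_const u).const_add xb
      simpa using hy.add (((ht0.pow 2).const_mul ((1:ℝ)/2)).smul hd)
    have hall : ∀ l, ∀ᶠ k in atTop,
        f l (xb + t k • u + ((1 : ℝ) / 2 * (t k) ^ 2) • d k) < f l xb := by
      intro l
      rcases hfu l with h | h
      · have hd' : Tendsto (fun k => u + ((1:ℝ) / 2 * t k) • d k) atTop (𝓝 u) := by
          simpa using ((ht0.const_mul ((1:ℝ)/2)).smul hd).const_add u
        filter_upwards [first_order (hf l) h ht ht0 hd'] with k hk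
        convert hk using 2
        rw [smul_add, smul_smul, ← add_assoc]
        congr 2
        ring
      · exact second_order (hf l) h.1 h.2 ht ht0 hd
    obtain ⟨k, hk1, hk2⟩ := ((eventually_all.2 hall).and (hx.eventually hU)).exists
    exact hw _ hk2 (hX k) hk1
  · have hneg : ∀ l, ⟪gradient (f l) xb, u⟫ < 0 := fun l =>
      lt_of_le_of_ne (hfu0 l) fun h => hcr ⟨l, h⟩
    obtain ⟨t, d, ht, ht0, hd, hX⟩ := hASCQ 0 ⟨by simp, ⟨hne.some, by simp⟩, by simp⟩
      (show u ∈ L2set g xb 0 from fun i hi => Or.inr ⟨by simp, by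
        simpa [d2max_zero] using hgu0 i hi⟩)
    have hs0 : Tendsto (fun k => (1:ℝ) / 2 * (t k) ^ 2) atTop (𝓝 0) := by
      simpa using (ht0.pow 2).const_mul ((1:ℝ)/2)
    have hs : ∀ k, 0 < (1:ℝ) / 2 * (t k) ^ 2 := fun k => by have := ht k; positivity
    have hx : Tendsto (fun k => xb + ((1 : ℝ) / 2 * (t k) ^ 2) • d k) atTop (𝓝 xb) := by
      simpa using (hs0.smul hd).const_add xb
    obtain ⟨k, hk1, hk2⟩ := ((eventually_all.2 fun l =>
      first_order (hf l) (hneg l) hs hs0 hd).and (hx.eventually hU)).exists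
    have hXk := hX k
    rw [smul_zero, add_zero] at hXk
    exact hw _ hk2 hXk hk1
end
end

section
/- Let g : ℝⁿ → ℝ be of class C^{1,1}, let x̄, u, v ∈ ℝⁿ with g(x̄) = 0 and ⟨∇g(x̄), u⟩ = 0, and let t_k ↓ 0 and v^k → v be sequences such that g(x̄ + t_k u + (1/2) t_k² v^k) ≤ 0 for all k. Then there exists ζ ∈ ∂²g(x̄)(u) such that ⟨∇g(x̄), v⟩ + ⟨ζ, u⟩ ≤ 0; in particular, ⟨∇g(x̄), v⟩ + min{⟨ζ, u⟩ : ζ ∈ ∂²g(x̄)(u)} ≤ 0. -/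
open Filter Topology RealInnerProductSpace

noncomputable section

theorem aux_bdd {n : ℕ} {h : En n → ℝ} {xb : En n} {r L : ℝ}
    (hL : ∀ x ∈ Metric.ball xb r, ∀ y ∈ Metric.ball xb r, |h x - h y| ≤ L * ‖x - y‖)
    {x : En n} (hx : x ∈ Metric.ball xb r) (w : En n) :
    ∀ᶠ y in 𝓝[≠] x, |(h y - h x - ⟪w, y - x⟫) / ‖y - x‖| ≤ L + ‖w‖ := by
  have h1 : ∀ᶠ y in 𝓝[≠] x, y ∈ Metric.ball xb r :=
    nhdsWithin_le_nhds (Metric.isOpen_ball.mem_nhds hx)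
  filter_upwards [h1, self_mem_nhdsWithin] with y hy hne
  have hpos : 0 < ‖y - x‖ := norm_pos_iff.2 (sub_ne_zero.2 hne)
  rw [abs_div, abs_of_pos hpos, div_le_iff₀ hpos]
  have h2 := hL y hy x hx
  have h3 := abs_real_inner_le_norm w (y - x)
  have h4 := abs_sub (h y - h x) ⟪w, y - x⟫
  linarith

theorem aux_norm {n : ℕ} {h : En n → ℝ} {xb : En n} {r L : ℝ} (hL0 : 0 ≤ L)
    (hL : ∀ x ∈ Metric.ball xb r, ∀ y ∈ Metric.ball xb r, |h x - h y| ≤ L * ‖x - y‖)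
    {x : En n} (hx : x ∈ Metric.ball xb r) {w : En n} (hw : w ∈ frechetSubdiff h x) :
    ‖w‖ ≤ L + 1 := by
  by_cases hw0 : w = 0
  · subst hw0; simp; linarith
  have hwp : 0 < ‖w‖ := norm_pos_iff.2 hw0
  have hw' : 0 ≤ Filter.liminf (fun y => (h y - h x - ⟪w, y - x⟫) / ‖y - x‖) (𝓝[≠] x) := hw
  have hb := aux_bdd hL hx w
  have hbd : IsBoundedUnder (· ≥ ·) (𝓝[≠] x)
      (fun y => (h y - h x - ⟪w, y - x⟫) / ‖y - x‖) :=
    ⟨-(L + ‖w‖), by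
      rw [eventually_map]
      filter_upwards [hb] with y hy using (abs_le.1 hy).1⟩
  have hlt : (-1 : ℝ) < Filter.liminf (fun y => (h y - h x - ⟪w, y - x⟫) / ‖y - x‖) (𝓝[≠] x) := by
    linarith
  have hev := eventually_lt_of_lt_liminf hlt hbd
  have hin : ∀ᶠ y in 𝓝[≠] x, y ∈ Metric.ball xb r :=
    nhdsWithin_le_nhds (Metric.isOpen_ball.mem_nhds hx)
  have hten : Tendsto (fun τ : ℝ => x + τ • w) (𝓝[>] 0) (𝓝[≠] x) := by
    apply tendsto_nhdsWithin_of_tendsto_nhds_of_eventually_within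
    · have : Continuous (fun τ : ℝ => x + τ • w) := by fun_prop
      have h2 := this.tendsto 0
      simp only [zero_smul, add_zero] at h2
      exact h2.mono_left nhdsWithin_le_nhds
    · filter_upwards [self_mem_nhdsWithin] with τ hτ
      have : τ ≠ 0 := ne_of_gt hτ
      simp [this, hw0]
  obtain ⟨τ, ⟨h1, h2⟩, hτ⟩ :=
    ((hten.eventually (hev.and hin)).and self_mem_nhdsWithin).exists
  have hτ' : 0 < τ := hτ
  have h3 := hL _ h2 x hx
  simp only [add_sub_cancel_left, norm_smul, Real.norm_eq_abs, abs_of_pos hτ',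
    real_inner_smul_right, real_inner_self_eq_norm_sq] at h1 h3
  have hp : 0 < τ * ‖w‖ := by positivity
  rw [lt_div_iff₀ hp] at h1
  have h4 := (abs_le.1 h3).2
  by_contra hcon
  push Not at hcon
  nlinarith

theorem aux_mem {n : ℕ} {h : En n → ℝ} {xb : En n} {r L : ℝ}
    (hL : ∀ x ∈ Metric.ball xb r, ∀ y ∈ Metric.ball xb r, |h x - h y| ≤ L * ‖x - y‖)
    {x : En n} (hx : x ∈ Metric.ball xb r) (p : En n) (M : ℝ) 
    (hmin : ∀ᶠ y in 𝓝 x, h x + M * ‖x - p‖ ^ 2 ≤ h y + M * ‖y - p‖ ^ 2) :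
    (-(2 * M)) • (x - p) ∈ frechetSubdiff h x := by
  set w := (-(2 * M)) • (x - p) with hw
  change 0 ≤ Filter.liminf (fun y => (h y - h x - ⟪w, y - x⟫) / ‖y - x‖) (𝓝[≠] x)
  rcases eq_or_neBot (𝓝[≠] x) with hbot | hne
  · rw [hbot]; simp [Filter.liminf, Filter.limsInf]
  have hb := aux_bdd hL hx w
  have hbd : IsBoundedUnder (· ≤ ·) (𝓝[≠] x)
      (fun y => (h y - h x - ⟪w, y - x⟫) / ‖y - x‖) :=
    ⟨(L + ‖w‖), by
      rw [eventually_map]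
      filter_upwards [hb] with y hy using (abs_le.1 hy).2⟩
  refine le_of_forall_pos_le_add fun ε hε => ?_
  suffices -ε ≤ Filter.liminf (fun y => (h y - h x - ⟪w, y - x⟫) / ‖y - x‖) (𝓝[≠] x) by linarith
  refine le_liminf_of_le hbd.isCoboundedUnder_ge ?_
  have hsm : ∀ᶠ y in 𝓝 x, M * ‖y - x‖ < ε := by
    have : Continuous (fun y : En n => M * ‖y - x‖) := by fun_prop
    have h2 := this.tendsto x
    simp only [sub_self, norm_zero, mul_zero] at h2
    exact h2.eventually_lt_const hε
  filter_upwards [nhdsWithin_le_nhds hmin, nhdsWithin_le_nhds hsm, self_mem_nhdsWithin]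
    with y h1 h2 hyx
  have hpos : 0 < ‖y - x‖ := norm_pos_iff.2 (sub_ne_zero.2 hyx)
  rw [le_div_iff₀ hpos]
  have h3 : ‖y - p‖ ^ 2 = ‖y - x‖ ^ 2 + 2 * ⟪x - p, y - x⟫ + ‖x - p‖ ^ 2 := by
    have : y - p = (y - x) + (x - p) := by abel
    rw [this, norm_add_sq_real, real_inner_comm]
  rw [h3] at h1
  have h4 : ⟪w, y - x⟫ = -(2 * M) * ⟪x - p, y - x⟫ := by rw [hw, real_inner_smul_left]
  rw [h4]
  nlinarith

theorem aux_mvt_s12 {n : ℕ} {h : En n → ℝ} {xb u : En n} {r L s b ε : ℝ} (hr : 0 < r) (hL0 : 0 ≤ L)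
    (hL : ∀ x ∈ Metric.ball xb r, ∀ y ∈ Metric.ball xb r, |h x - h y| ≤ L * ‖x - y‖)
    (hs : 0 < s) (hε : 0 < ε) (hsu : s * ‖u‖ < r / 4)
    (hdec : h (xb + s • u) ≤ h xb - s * b) :
    ∃ x w, x ∈ Metric.ball xb r ∧ w ∈ frechetSubdiff h x ∧ ⟪w, u⟫ ≤ -b + ε := by
  obtain ⟨M, hM0, hM1, hM2⟩ : ∃ M : ℝ, 0 < M ∧ L < M * (r / 4) ∧ L ^ 2 < 4 * M * (ε * s) := by
    have e1 : ∀ᶠ M : ℝ in atTop, L < M * (r / 4) :=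
      (tendsto_id.atTop_mul_const (by positivity : (0:ℝ) < r / 4)).eventually_gt_atTop L
    have e2 : ∀ᶠ M : ℝ in atTop, L ^ 2 < M * (4 * (ε * s)) :=
      (tendsto_id.atTop_mul_const (by positivity : (0:ℝ) < 4 * (ε * s))).eventually_gt_atTop (L ^ 2)
    obtain ⟨M, ⟨h1, h2⟩, h3⟩ := ((e1.and e2).and (eventually_gt_atTop 0)).exists
    exact ⟨M, h3, h1, by linarith⟩
  have hsub : Metric.closedBall xb (r / 2) ⊆ Metric.ball xb r :=
    Metric.closedBall_subset_ball (by linarith)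
  have hcont : ContinuousOn h (Metric.ball xb r) := by
    have : LipschitzOnWith (Real.toNNReal L) h (Metric.ball xb r) := by
      apply LipschitzOnWith.of_dist_le_mul
      intro x hx y hy
      rw [Real.dist_eq, dist_eq_norm, Real.coe_toNNReal _ hL0]
      exact hL x hx y hy
    exact this.continuousOn
  let F : ℝ × En n → ℝ := fun q => h q.2 + (b - ε) * q.1 + M * ‖q.2 - (xb + q.1 • u)‖ ^ 2
  have hK : IsCompact (Set.Icc (0:ℝ) s ×ˢ Metric.closedBall xb (r / 2)) :=
    isCompact_Icc.prod (isCompact_closedBall _ _)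
  have hpin : ∀ τ ∈ Set.Icc (0:ℝ) s, xb + τ • u ∈ Metric.closedBall xb (r / 4) := by
    intro τ hτ
    rw [mem_closedBall_iff_norm, add_sub_cancel_left, norm_smul, Real.norm_eq_abs,
      abs_of_nonneg hτ.1]
    have := mul_le_mul_of_nonneg_right hτ.2 (norm_nonneg u)
    linarith
  have hpin2 : ∀ τ ∈ Set.Icc (0:ℝ) s, xb + τ • u ∈ Metric.closedBall xb (r / 2) := fun τ hτ =>
    Metric.closedBall_subset_closedBall (by linarith) (hpin τ hτ)
  have hF : ContinuousOn F (Set.Icc (0:ℝ) s ×ˢ Metric.closedBall xb (r / 2)) := by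
    have h1 : ContinuousOn (fun q : ℝ × En n => h q.2)
        (Set.Icc (0:ℝ) s ×ˢ Metric.closedBall xb (r / 2)) :=
      hcont.comp continuousOn_snd (fun q hq => hsub hq.2)
    have h2 : Continuous (fun q : ℝ × En n => (b - ε) * q.1) := by fun_prop
    have h3 : Continuous (fun q : ℝ × En n => M * ‖q.2 - (xb + q.1 • u)‖ ^ 2) := by fun_prop
    exact (h1.add h2.continuousOn).add h3.continuousOn
  have hs_mem : s ∈ Set.Icc (0:ℝ) s := ⟨hs.le, le_rfl⟩
  obtain ⟨⟨τ, x⟩, ⟨hτ, hx⟩, hmin⟩ := hK.exists_isMinOn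
    ⟨(s, xb + s • u), hs_mem, hpin2 s hs_mem⟩ hF
  rw [isMinOn_iff] at hmin
  simp only at hτ hx
  have hmin' : ∀ τ' ∈ Set.Icc (0:ℝ) s, ∀ y ∈ Metric.closedBall xb (r / 2),
      h x + (b - ε) * τ + M * ‖x - (xb + τ • u)‖ ^ 2 ≤
      h y + (b - ε) * τ' + M * ‖y - (xb + τ' • u)‖ ^ 2 :=
    fun τ' h1 y h2 => hmin (τ', y) ⟨h1, h2⟩
  set p := xb + τ • u with hp
  -- x is close to p
  have hxp : ‖x - p‖ < r / 4 := by
    have h1 := hmin' τ hτ p (hpin2 τ hτ)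
    have h2 := (abs_le.1 (hL x (hsub hx) p (hsub (hpin2 τ hτ)))).1
    rw [← hp, sub_self, norm_zero] at h1
    by_contra hcon
    push Not at hcon
    have : M * (r / 4) ≤ M * ‖x - p‖ := mul_le_mul_of_nonneg_left hcon hM0.le
    nlinarith
  have hxball : x ∈ Metric.ball xb (r / 2) := by
    have h1 := hpin τ hτ
    rw [← hp, mem_closedBall_iff_norm] at h1
    rw [mem_ball_iff_norm]
    have : x - xb = (x - p) + (p - xb) := by abel
    rw [this]
    exact (norm_add_le _ _).trans_lt (by linarith)
  have hτ0 : 0 < τ := by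
    rcases hτ.1.lt_or_eq with h0 | h0
    · exact h0
    exfalso
    have h1 := hmin' s hs_mem _ (hpin2 s hs_mem)
    have hpx : p = xb := by rw [hp, ← h0]; simp
    rw [sub_self, norm_zero, ← h0, hpx] at h1
    have h2 := (abs_le.1 (hL x (hsub hx) xb (Metric.mem_ball_self hr))).1
    nlinarith [sq_nonneg (2 * M * ‖x - xb‖ - L)]
  refine ⟨x, (-(2 * M)) • (x - p), hsub hx, aux_mem hL (hsub hx) p M ?_, ?_⟩
  · filter_upwards [Metric.isOpen_ball.mem_nhds hxball] with y hy
    have := hmin' τ hτ y (Metric.ball_subset_closedBall hy)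
    linarith
  · rw [real_inner_smul_left]
    -- left perturbation of τ
    have key : ∀ η ∈ Set.Ioo (0:ℝ) τ, (b - ε) - 2 * M * ⟪x - p, u⟫ ≤ M * ‖u‖ ^ 2 * η := by
      intro η hη
      have h1 := hmin' (τ - η) ⟨by linarith [hη.2], by linarith [hη.1, hτ.2]⟩ x hx
      have h2 : x - (xb + (τ - η) • u) = (x - p) + η • u := by
        rw [hp, sub_smul]; abel
      rw [h2, norm_add_sq_real, real_inner_smul_right, norm_smul, Real.norm_eq_abs,
        abs_of_pos hη.1] at h1
      have h3 : η * ((b - ε) - 2 * M * ⟪x - p, u⟫) ≤ η * (M * ‖u‖ ^ 2 * η) := by nlinarith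
      exact le_of_mul_le_mul_left h3 hη.1
    have hlim : Tendsto (fun η : ℝ => M * ‖u‖ ^ 2 * η) (𝓝[>] 0) (𝓝 0) := by
      have : Continuous (fun η : ℝ => M * ‖u‖ ^ 2 * η) := by fun_prop
      have h2 := this.tendsto 0
      rw [mul_zero] at h2
      exact h2.mono_left nhdsWithin_le_nhds
    have := ge_of_tendsto hlim (by
      filter_upwards [Ioo_mem_nhdsGT hτ0] with η hη using key η hη)
    linarith

theorem aux_taylor {n : ℕ} (g : En n → ℝ) (hd : Differentiable ℝ g)
    (hc : Continuous (fun x => gradient g x))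
    (xb u v : En n) (hg0 : g xb = 0)
    (t : ℕ → ℝ) (vk : ℕ → En n)
    (ht : ∀ k, 0 < t k) (ht0 : Tendsto t atTop (𝓝 0))
    (hvk : Tendsto vk atTop (𝓝 v))
    (hfeas : ∀ k, g (xb + t k • u + ((1 : ℝ) / 2 * (t k) ^ 2) • vk k) ≤ 0)
    {ε δ : ℝ} (hε : 0 < ε) (hδ : 0 < δ) :
    ∃ s, 0 < s ∧ s < δ ∧ ⟪u, gradient g (xb + s • u)⟫ ≤ - s * (⟪gradient g xb, v⟫ - ε) := by
  have hgrad : ∀ x, HasFDerivAt g (innerSL ℝ (gradient g x)) x := by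
    intro x
    exact (hd x).hasGradientAt.hasFDerivAt
  have hcont : ContinuousAt (fun q : En n × En n => ⟪gradient g q.1, q.2⟫) (xb, v) := by
    have : Continuous (fun q : En n × En n => ⟪gradient g q.1, q.2⟫) :=
      (hc.comp continuous_fst).inner continuous_snd
    exact this.continuousAt
  have hev := hcont.eventually (lt_mem_nhds (show ⟪gradient g xb, v⟫ - ε < ⟪gradient g xb, v⟫ by
    linarith))
  rw [nhds_prod_eq] at hev
  obtain ⟨pa, hpa, pb, hpb, hab⟩ := eventually_prod_iff.1 hev
  obtain ⟨ρ, hρ, hball⟩ := Metric.eventually_nhds_iff_ball.1 hpa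
  have hA : Tendsto (fun k => xb + t k • u) atTop (𝓝 xb) := by
    have := tendsto_const_nhds (x := xb).add (ht0.smul_const u)
    simpa using this
  have hB : Tendsto (fun k => xb + t k • u + ((1 : ℝ) / 2 * (t k) ^ 2) • vk k) atTop (𝓝 xb) := by
    have := hA.add (((ht0.pow 2).const_mul ((1:ℝ)/2)).smul hvk)
    simpa using this
  obtain ⟨k, ⟨⟨hkA, hkB⟩, hkv⟩, hkδ⟩ := (((hA.eventually (Metric.ball_mem_nhds xb hρ)).and
    (hB.eventually (Metric.ball_mem_nhds xb hρ))).and (hvk.eventually hpb)).and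
    (ht0.eventually_lt_const hδ) |>.exists
  have htk := ht k
  obtain ⟨z, hz, hzeq⟩ := domain_mvt (s := Metric.ball xb ρ)
    (fun x _ => (hgrad x).hasFDerivWithinAt) (convex_ball xb ρ) hkA hkB
  have hz' : z ∈ Metric.ball xb ρ := (convex_ball xb ρ).segment_subset hkA hkB hz
  have h1 := hab (hball z hz') hkv
  simp only [add_sub_cancel_left, innerSL_apply_apply, real_inner_smul_right] at hzeq h1
  have hf := hfeas k
  have hG : ∀ s : ℝ, HasDerivAt (fun s : ℝ => g (xb + s • u)) ⟪gradient g (xb + s • u), u⟫ s := by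
    intro s
    have h2 : HasDerivAt (fun s : ℝ => xb + s • u) u s := by
      simpa using ((hasDerivAt_id s).smul_const u).const_add xb
    exact (hgrad (xb + s • u)).comp_hasDerivAt s h2
  have hQ : ∀ s : ℝ, HasDerivAt (fun s : ℝ => s ^ 2) (2 * s) s := by
    intro s; simpa using hasDerivAt_pow 2 s
  obtain ⟨s, hs, hseq⟩ := exists_ratio_hasDerivAt_eq_ratio_slope
    (fun s : ℝ => g (xb + s • u)) (fun s => ⟪gradient g (xb + s • u), u⟫) htk
    (fun s _ => (hG s).continuousAt.continuousWithinAt) (fun s _ => hG s)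
    (fun s : ℝ => s ^ 2) (fun s => 2 * s)
    (fun s _ => (hQ s).continuousAt.continuousWithinAt) (fun s _ => hQ s)
  simp only [zero_smul, add_zero, hg0, sub_zero, ne_eq, OfNat.ofNat_ne_zero, not_false_eq_true,
    zero_pow] at hseq
  refine ⟨s, hs.1, hs.2.trans hkδ, ?_⟩
  rw [real_inner_comm]
  have ht2 : 0 < t k ^ 2 := by positivity
  have hub : g (xb + t k • u) ≤ -(1 / 2 * t k ^ 2 * (⟪gradient g xb, v⟫ - ε)) := by
    have := mul_lt_mul_of_pos_left h1 (show 0 < 1 / 2 * t k ^ 2 by positivity)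
    linarith
  have h5 : t k ^ 2 * ⟪gradient g (xb + s • u), u⟫ ≤
      t k ^ 2 * (- s * (⟪gradient g xb, v⟫ - ε)) := by
    rw [hseq]
    have := mul_le_mul_of_nonneg_right hub (show 0 ≤ 2 * s by linarith [hs.1])
    linarith
  exact le_of_mul_le_mul_left h5 ht2

/-- second-order information from feasible second-order sequences. -/
theorem stmt12 {n : ℕ} (g : En n → ℝ) (hg : IsC11 g)
    (xb u v : En n) (hg0 : g xb = 0) (hgu : ⟪gradient g xb, u⟫ = 0)
    (t : ℕ → ℝ) (vk : ℕ → En n)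
    (ht : ∀ k, 0 < t k) (ht0 : Tendsto t atTop (𝓝 0))
    (hvk : Tendsto vk atTop (𝓝 v))
    (hfeas : ∀ k, g (xb + t k • u + ((1 : ℝ) / 2 * (t k) ^ 2) • vk k) ≤ 0) :
    (∃ ζ ∈ secondSubdiff g xb u, ⟪gradient g xb, v⟫ + ⟪ζ, u⟫ ≤ 0) ∧
      ⟪gradient g xb, v⟫ + d2min g xb u ≤ 0 := by
  obtain ⟨hd, hlip⟩ := hg
  have hc : Continuous (fun x => gradient g x) := hlip.continuous
  obtain ⟨K, S, hS, hKS⟩ := hlip xb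
  obtain ⟨r, hr, hrS⟩ := Metric.mem_nhds_iff.1 hS
  set h : En n → ℝ := fun x => ⟪u, gradient g x⟫ with hh
  set L : ℝ := ‖u‖ * K with hLdef
  have hL0 : 0 ≤ L := by positivity
  have hL : ∀ x ∈ Metric.ball xb r, ∀ y ∈ Metric.ball xb r, |h x - h y| ≤ L * ‖x - y‖ := by
    intro x hx y hy
    have h1 := hKS.dist_le_mul x (hrS hx) y (hrS hy)
    rw [dist_eq_norm, dist_eq_norm] at h1
    have h2 : h x - h y = ⟪u, gradient g x - gradient g y⟫ := by rw [hh, inner_sub_right]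
    rw [h2]
    refine (abs_real_inner_le_norm _ _).trans ?_
    rw [hLdef, mul_assoc]
    exact mul_le_mul_of_nonneg_left h1 (norm_nonneg u)
  set a := ⟪gradient g xb, v⟫ with ha
  have hex : ∀ k : ℕ, ∃ x w, x ∈ Metric.ball xb (min r (1 / ((k:ℝ) + 1))) ∧
      w ∈ frechetSubdiff h x ∧ ⟪w, u⟫ ≤ -a + 2 * (1 / ((k:ℝ) + 1)) := by
    intro k
    have he : (0:ℝ) < 1 / ((k:ℝ) + 1) := by positivity
    set e := 1 / ((k:ℝ) + 1)
    have hr' : 0 < min r e := lt_min hr he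
    obtain ⟨s, hs, hsδ, hsle⟩ := aux_taylor g hd hc xb u v hg0 t vk ht ht0 hvk hfeas he
      (show 0 < min r e / 4 / (‖u‖ + 1) by positivity)
    have hsub : Metric.ball xb (min r e) ⊆ Metric.ball xb r :=
      Metric.ball_subset_ball (min_le_left _ _)
    have hsu : s * ‖u‖ < min r e / 4 := by
      rw [lt_div_iff₀ (by positivity)] at hsδ
      nlinarith
    obtain ⟨x, w, hx, hw, hwu⟩ := aux_mvt_s12 (h := h) (xb := xb) (u := u) (b := a - e) hr' hL0
      (fun x hx y hy => hL x (hsub hx) y (hsub hy)) hs he hsu (by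
        have h0 : h xb = 0 := by rw [hh]; simpa [real_inner_comm] using hgu
        rw [h0]
        have : h (xb + s • u) ≤ -s * (a - e) := hsle
        linarith)
    exact ⟨x, w, hx, hw, by linarith⟩
  choose x w hx hw hwu using hex
  have hxr : ∀ k, x k ∈ Metric.ball xb r := fun k =>
    Metric.ball_subset_ball (min_le_left _ _) (hx k)
  have he0 : Tendsto (fun k : ℕ => 1 / ((k:ℝ) + 1)) atTop (𝓝 0) :=
    tendsto_one_div_add_atTop_nhds_zero_nat
  have hxt : Tendsto x atTop (𝓝 xb) := by
    rw [tendsto_iff_dist_tendsto_zero]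
    refine squeeze_zero (fun _ => dist_nonneg) (fun k => ?_) he0
    exact (Metric.mem_ball.1 (hx k)).le.trans (min_le_right _ _)
  have hwb : ∀ k, w k ∈ Metric.closedBall (0 : En n) (L + 1) := fun k => by
    rw [mem_closedBall_zero_iff]
    exact aux_norm hL0 hL (hxr k) (hw k)
  obtain ⟨ζ, _, φ, hφ, hζ⟩ := (isCompact_closedBall (0 : En n) (L + 1)).tendsto_subseq hwb
  have hmem : ζ ∈ secondSubdiff g xb u :=
    ⟨x ∘ φ, w ∘ φ, hxt.comp hφ.tendsto_atTop, hζ, fun k => hw (φ k)⟩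
  have hle : ⟪ζ, u⟫ ≤ -a := by
    have h1 : Tendsto (fun k => ⟪(w ∘ φ) k, u⟫) atTop (𝓝 ⟪ζ, u⟫) := hζ.inner tendsto_const_nhds
    have h2 : Tendsto (fun k => -a + 2 * (1 / (((φ k : ℕ):ℝ) + 1))) atTop (𝓝 (-a)) := by
      have := ((he0.comp hφ.tendsto_atTop).const_mul 2).const_add (-a)
      simpa using this
    exact le_of_tendsto_of_tendsto' h1 h2 (fun k => hwu (φ k))
  refine ⟨⟨ζ, hmem, by linarith⟩, ?_⟩
  have hbdd : BddBelow ((fun ζ => ⟪ζ, u⟫) '' secondSubdiff g xb u) := by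
    refine ⟨-((L + 1) * ‖u‖), ?_⟩
    rintro _ ⟨ξ, ⟨y, q, hy, hq, hyq⟩, rfl⟩
    have hn : ‖ξ‖ ≤ L + 1 := by
      refine le_of_tendsto hq.norm ?_
      filter_upwards [hy.eventually (Metric.ball_mem_nhds xb hr)] with k hk
      exact aux_norm hL0 hL hk (hyq k)
    have h1 := (abs_le.1 (abs_real_inner_le_norm ξ u)).1
    have h2 := mul_le_mul_of_nonneg_right hn (norm_nonneg u)
    simp only
    linarith
  have : d2min g xb u ≤ ⟪ζ, u⟫ := csInf_le hbdd ⟨ζ, hmem, rfl⟩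
  linarith
end
end

section
/- Let g : ℝⁿ → ℝ be of class C^{1,1} and let x̄, u, v ∈ ℝⁿ satisfy g(x̄) = 0, ⟨∇g(x̄), u⟩ = 0, and ⟨∇g(x̄), v⟩ + max{⟨ζ, u⟩ : ζ ∈ ∂²g(x̄)(u)} < 0. Then for every pair of sequences t_k ↓ 0 and v^k → v, one has g(x̄ + t_k u + (1/2) t_k² v^k) < 0 for all sufficiently large k. -/
open Filter Topology RealInnerProductSpace

noncomputable section

theorem aux_mem_frechet_s13 {n : ℕ} [Nontrivial (En n)] {h : En n → ℝ} {w x : En n}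
    (hw : HasGradientAt h w x) : w ∈ frechetSubdiff h x := by
  have h1 := hasGradientAt_iff_tendsto.1 hw
  have h2 : Tendsto (fun y => (h y - h x - ⟪w, y - x⟫) / ‖y - x‖) (𝓝 x) (𝓝 0) := by
    rw [tendsto_zero_iff_norm_tendsto_zero]
    refine h1.congr fun y => ?_
    rw [norm_div, norm_norm, div_eq_inv_mul]
  have h3 := (h2.mono_left (nhdsWithin_le_nhds (s := {x}ᶜ))).liminf_eq
  exact h3.ge

theorem aux_frechet_bound {n : ℕ} {h : En n → ℝ} {w y u : En n} {K : ℝ}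
    (hK : ∀ᶠ z in 𝓝 y, |h z - h y| ≤ K * ‖z - y‖)
    (hw : w ∈ frechetSubdiff h y) : ⟪w, u⟫ ≤ (K + 1) * ‖u‖ := by
  by_cases hu : u = 0
  · simp [hu]
  have hu' : 0 < ‖u‖ := norm_pos_iff.2 hu
  have hb : (𝓝[≠] y).IsBoundedUnder (· ≥ ·) (fun z => (h z - h y - ⟪w, z - y⟫) / ‖z - y‖) := by
    refine ⟨-(K + ‖w‖), ?_⟩
    rw [eventually_map]
    filter_upwards [nhdsWithin_le_nhds hK, self_mem_nhdsWithin] with z hz hne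
    have hpos : 0 < ‖z - y‖ := norm_pos_iff.2 (sub_ne_zero.2 hne)
    show _ ≤ _
    rw [le_div_iff₀ hpos]
    have := real_inner_le_norm w (z - y)
    have := (abs_le.1 hz).1
    nlinarith
  have hlt : (-1 : ℝ) < liminf (fun z => (h z - h y - ⟪w, z - y⟫) / ‖z - y‖) (𝓝[≠] y) :=
    lt_of_lt_of_le (by norm_num) hw
  have hev := eventually_lt_of_lt_liminf hlt hb
  have hpath : Tendsto (fun s : ℝ => y + s • u) (𝓝[>] 0) (𝓝[≠] y) := by
    rw [tendsto_nhdsWithin_iff]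
    constructor
    · have : Continuous (fun s : ℝ => y + s • u) := by fun_prop
      have := this.tendsto 0
      simp only [zero_smul, add_zero] at this
      exact this.mono_left nhdsWithin_le_nhds
    · filter_upwards [self_mem_nhdsWithin] with s hs
      have : s ≠ 0 := ne_of_gt hs
      simp [this, hu]
  obtain ⟨s, hs0, hs1, hs2⟩ := ((eventually_mem_nhdsWithin (a := (0:ℝ)) (s := Set.Ioi 0)).and
    ((hpath.eventually hev).and (hpath.eventually (nhdsWithin_le_nhds hK)))).exists
  have hs0 : 0 < s := hs0
  simp only [add_sub_cancel_left, norm_smul, Real.norm_eq_abs, abs_of_pos hs0,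
    inner_smul_right] at hs1 hs2
  rw [lt_div_iff₀ (by positivity)] at hs1
  have := (abs_le.1 hs2).2
  have : s * ⟪w, u⟫ ≤ s * ((K + 1) * ‖u‖) := by nlinarith
  exact le_of_mul_le_mul_left this hs0

theorem aux_mean {n : ℕ} {H : En n → ℝ} {K : NNReal} (hH : LipschitzWith K H)
    {xb u : En n} {r c : ℝ}
    (hc : ∀ y ∈ Metric.ball xb r, DifferentiableAt ℝ H y → fderiv ℝ H y u ≤ c)
    {s : ℝ} (hs : 0 ≤ s) (hsr : s * ‖u‖ < r) : H (xb + s • u) - H xb ≤ c * s := by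
  let L : ℝ →L[ℝ] En n := ContinuousLinearMap.smulRight (1 : ℝ →L[ℝ] ℝ) u
  have hae : ∀ᵐ x : En n, ∀ᵐ a : ℝ, DifferentiableAt ℝ H (x + a • u) := by
    have := (MeasureTheory.ae_ae_add_linearMap_mem_iff L.toLinearMap MeasureTheory.volume
      (MeasureTheory.volume : MeasureTheory.Measure (En n))
      (measurableSet_of_differentiableAt ℝ H)).2 hH.ae_differentiableAt
    simpa [L] using this
  have key : ∀ x : En n, (∀ᵐ a : ℝ, DifferentiableAt ℝ H (x + a • u)) →
      x ∈ Metric.ball xb (r - s * ‖u‖) → H (x + s • u) - H x ≤ c * s := by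
    intro x hx hxb
    have hlip : LipschitzWith (K * (0 + ‖L‖₊)) (fun a : ℝ => H (x + a • u)) :=
      hH.comp ((LipschitzWith.const x).add L.lipschitz)
    have hac := (hlip.lipschitzOnWith (s := Set.uIcc 0 s)).absolutelyContinuousOnInterval
    have h1 := hac.integral_deriv_eq_sub
    have h2 : ∫ a in (0:ℝ)..s, deriv (fun a : ℝ => H (x + a • u)) a ≤ ∫ a in (0:ℝ)..s, c := by
      refine intervalIntegral.integral_mono_ae_restrict hs hac.intervalIntegrable_deriv
        (by simp) ?_
      filter_upwards [MeasureTheory.ae_restrict_of_ae hx,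
        MeasureTheory.ae_restrict_mem measurableSet_Icc] with a ha has
      have h1 : HasDerivAt (fun a : ℝ => x + a • u) u a := by
        simpa using ((hasDerivAt_id a).smul_const u).const_add x
      have h2 : HasDerivAt (fun a : ℝ => H (x + a • u)) (fderiv ℝ H (x + a • u) u) a :=
        ha.hasFDerivAt.comp_hasDerivAt a h1
      rw [h2.deriv]
      refine hc _ ?_ ha
      rw [mem_ball_iff_norm] at hxb ⊢
      have e : x + a • u - xb = (x - xb) + a • u := by abel
      rw [e]
      have h3 := norm_add_le (x - xb) (a • u)
      rw [norm_smul, Real.norm_eq_abs, abs_of_nonneg has.1] at h3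
      have h4 : a * ‖u‖ ≤ s * ‖u‖ := by gcongr; exact has.2
      linarith
    simp at h1 h2
    linarith
  have hd : Dense {x : En n | ∀ᵐ a : ℝ, DifferentiableAt ℝ H (x + a • u)} :=
    MeasureTheory.Measure.dense_of_ae hae
  have hmem : xb ∈ closure (Metric.ball xb (r - s * ‖u‖) ∩
      {x : En n | ∀ᵐ a : ℝ, DifferentiableAt ℝ H (x + a • u)}) :=
    hd.open_subset_closure_inter Metric.isOpen_ball (Metric.mem_ball_self (by linarith))
  have hcl : IsClosed {x : En n | H (x + s • u) - H x ≤ c * s} := by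
    have := hH.continuous
    exact isClosed_le (by fun_prop) (by fun_prop)
  exact closure_minimal (fun x hx => key x hx.2 hx.1) hcl hmem

theorem aux_local {n : ℕ} [Nontrivial (En n)] {h H : En n → ℝ} {K : NNReal}
    (hH : LipschitzWith K H) {xb u : En n} {r₀ c : ℝ} (hr₀ : 0 < r₀)
    (heq : Set.EqOn h H (Metric.ball xb r₀))
    (hc : sSup ((fun ζ => ⟪ζ, u⟫) '' limitingSubdiff h xb) < c) :
    ∃ r > 0, ∀ y ∈ Metric.ball xb r, DifferentiableAt ℝ H y → fderiv ℝ H y u ≤ c := by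
  have hev : ∀ y ∈ Metric.ball xb r₀, h =ᶠ[𝓝 y] H := fun y hy =>
    heq.eventuallyEq_of_mem (Metric.isOpen_ball.mem_nhds hy)
  have hbdd : BddAbove ((fun ζ => ⟪ζ, u⟫) '' limitingSubdiff h xb) := by
    refine ⟨((K:ℝ) + 1) * ‖u‖, ?_⟩
    rintro _ ⟨ζ, ⟨x, w, hx, hw, hxw⟩, rfl⟩
    have ht : Tendsto (fun k => ⟪w k, u⟫) atTop (𝓝 ⟪ζ, u⟫) := hw.inner tendsto_const_nhds
    refine le_of_tendsto ht ?_
    filter_upwards [hx (Metric.ball_mem_nhds xb hr₀)] with k hk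
    refine aux_frechet_bound ?_ (hxw k)
    filter_upwards [hev _ hk] with z hz
    rw [hz, heq hk, ← Real.norm_eq_abs]
    exact hH.norm_sub_le _ _
  by_contra! hcon
  have hcon' : ∀ k : ℕ, ∃ y ∈ Metric.ball xb (min r₀ (1 / ((k:ℝ) + 1))),
      DifferentiableAt ℝ H y ∧ c < fderiv ℝ H y u := fun k =>
    hcon _ (lt_min hr₀ (by positivity))
  choose y hy hdiff hlt using hcon'
  have hytend : Tendsto y atTop (𝓝 xb) := by
    rw [tendsto_iff_dist_tendsto_zero]
    refine squeeze_zero (fun _ => dist_nonneg) (fun k => ?_) tendsto_one_div_add_atTop_nhds_zero_nat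
    exact (lt_of_lt_of_le (hy k) (min_le_right _ _)).le
  have hgrad : ∀ k, gradient H (y k) ∈ Metric.closedBall (0 : En n) K := by
    intro k
    rw [mem_closedBall_zero_iff, gradient, LinearIsometryEquiv.norm_map]
    exact norm_fderiv_le_of_lipschitz ℝ hH
  obtain ⟨ζ, -, φ, hφ, hζ⟩ := (isCompact_closedBall (0 : En n) (K:ℝ)).tendsto_subseq hgrad
  have hζmem : ζ ∈ limitingSubdiff h xb := by
    refine ⟨y ∘ φ, _, hytend.comp hφ.tendsto_atTop, hζ, fun k => ?_⟩
    apply aux_mem_frechet_s13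
    have hb : y (φ k) ∈ Metric.ball xb r₀ :=
      Metric.ball_subset_ball (min_le_left _ _) (hy (φ k))
    exact (hdiff (φ k)).hasGradientAt.congr_of_eventuallyEq (hev _ hb)
  have hle : c ≤ ⟪ζ, u⟫ := by
    have ht : Tendsto (fun k => ⟪gradient H (y (φ k)), u⟫) atTop (𝓝 ⟪ζ, u⟫) :=
      hζ.inner tendsto_const_nhds
    refine ge_of_tendsto' ht fun k => ?_
    have := hlt (φ k)
    rw [gradient, InnerProductSpace.toDual_symm_apply]
    exact this.le
  have := le_csSup hbdd ⟨ζ, hζmem, rfl⟩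
  simp only at this
  linarith

/-- strict second-order descent along second-order sequences. -/
theorem stmt13 {n : ℕ} (g : En n → ℝ) (hg : IsC11 g)
    (xb u v : En n) (hg0 : g xb = 0) (hgu : ⟪gradient g xb, u⟫ = 0)
    (hstrict : ⟪gradient g xb, v⟫ + d2max g xb u < 0)
    (t : ℕ → ℝ) (vk : ℕ → En n)
    (ht : ∀ k, 0 < t k) (ht0 : Tendsto t atTop (𝓝 0))
    (hvk : Tendsto vk atTop (𝓝 v)) :
    ∀ᶠ k in atTop, g (xb + t k • u + ((1 : ℝ) / 2 * (t k) ^ 2) • vk k) < 0 := by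
  rcases subsingleton_or_nontrivial (En n) with hsub | hnt
  · exfalso
    have hu : u = 0 := Subsingleton.elim _ _
    have hv : v = 0 := Subsingleton.elim _ _
    have : d2max g xb u = 0 := by
      unfold d2max
      rcases (secondSubdiff g xb u).eq_empty_or_nonempty with he | he
      · simp [he]
      · rw [hu]
        rw [hu] at he
        simp [he.image_const]
    rw [this, hv] at hstrict
    simp at hstrict
  obtain ⟨hdiff, hlipg⟩ := hg
  have hgradc : Continuous (fun x => gradient g x) := hlipg.continuous
  have hlip : LocallyLipschitz (fun x => ⟪u, gradient g x⟫) := by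
    have h1 : LipschitzWith ‖innerSL ℝ u‖₊ (innerSL ℝ u) := (innerSL ℝ u).lipschitz
    exact h1.locallyLipschitz.comp hlipg
  obtain ⟨K, U, hU, hKU⟩ := hlip xb
  obtain ⟨r₀, hr₀, hball⟩ := Metric.mem_nhds_iff.1 hU
  obtain ⟨H, hH, heq⟩ := (hKU.mono hball).extend_real
  obtain ⟨c, hc1, hc2⟩ : ∃ c, d2max g xb u < c ∧ c < -⟪gradient g xb, v⟫ :=
    exists_between (by linarith)
  obtain ⟨r, hr, hrc⟩ := aux_local hH hr₀ heq hc1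
  -- the first-order growth of `⟨u, ∇g⟩` along the ray
  have hgrow : ∀ s : ℝ, 0 ≤ s → s * ‖u‖ < min r r₀ → ⟪gradient g (xb + s • u), u⟫ ≤ c * s := by
    intro s hs hsr
    have h1 := aux_mean hH hrc hs (lt_of_lt_of_le hsr (min_le_left _ _))
    have h2 : xb + s • u ∈ Metric.ball xb r₀ := by
      rw [mem_ball_iff_norm, add_sub_cancel_left, norm_smul, Real.norm_eq_abs, abs_of_nonneg hs]
      exact lt_of_lt_of_le hsr (min_le_right _ _)
    rw [← heq h2, ← heq (Metric.mem_ball_self hr₀)] at h1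
    simp only [real_inner_comm] at h1 hgu ⊢
    linarith
  have hray : ∀ s : ℝ, 0 ≤ s → s * ‖u‖ < min r r₀ → g (xb + s • u) ≤ c * s ^ 2 / 2 := by
    intro s hs hsr
    have hder : ∀ a : ℝ, HasDerivAt (fun a : ℝ => g (xb + a • u) - c * a ^ 2 / 2)
        (⟪gradient g (xb + a • u), u⟫ - c * a) a := by
      intro a
      have h1 : HasDerivAt (fun a : ℝ => xb + a • u) u a := by
        simpa using ((hasDerivAt_id a).smul_const u).const_add xb
      have h2 := ((hdiff (xb + a • u)).hasGradientAt.hasFDerivAt).comp_hasDerivAt a h1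
      have h3 : HasDerivAt (fun a : ℝ => c * a ^ 2 / 2) (c * a) a := by
        have h5 := ((hasDerivAt_pow 2 a).const_mul c).div_const 2
        have e : c * (((2 : ℕ) : ℝ) * a ^ (2 - 1)) / 2 = c * a := by norm_num; ring
        rw [e] at h5
        exact h5
      have h4 : HasDerivAt (fun a : ℝ => g (xb + a • u))
          ⟪gradient g (xb + a • u), u⟫ a := by
        exact h2
      exact h4.sub h3
    have hanti : AntitoneOn (fun a : ℝ => g (xb + a • u) - c * a ^ 2 / 2) (Set.Icc 0 s) := by
      refine antitoneOn_of_deriv_nonpos (convex_Icc 0 s)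
        (fun a _ => (hder a).continuousAt.continuousWithinAt)
        (fun a _ => (hder a).differentiableAt.differentiableWithinAt) fun a ha => ?_
      rw [interior_Icc] at ha
      rw [(hder a).deriv]
      have : a * ‖u‖ ≤ s * ‖u‖ := by gcongr; exact ha.2.le
      have := hgrow a ha.1.le (by linarith)
      linarith
    have := hanti (Set.left_mem_Icc.2 hs) (Set.right_mem_Icc.2 hs) hs
    simp [hg0] at this
    linarith
  -- strict differentiability at `xb`
  have hstr : HasStrictFDerivAt g (fderiv ℝ g xb) xb := by
    refine hasStrictFDerivAt_of_hasFDerivAt_of_continuousAt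
      (Eventually.of_forall fun x => (hdiff x).hasFDerivAt) ?_
    have : (fun x => fderiv ℝ g x) = fun x => InnerProductSpace.toDual ℝ (En n) (gradient g x) := by
      funext x; simp [gradient]
    have hcont : Continuous (fun x => fderiv ℝ g x) := by
      rw [this]
      exact (LinearIsometryEquiv.continuous _).comp hgradc
    exact hcont.continuousAt
  obtain ⟨ε, hε, hεc⟩ : ∃ ε > 0, c + ⟪gradient g xb, v⟫ + ε * ‖v‖ < 0 := by
    refine ⟨-(c + ⟪gradient g xb, v⟫) / (2 * (‖v‖ + 1)), div_pos (by linarith) (by positivity), ?_⟩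
    have hv := norm_nonneg v
    have : -(c + ⟪gradient g xb, v⟫) / (2 * (‖v‖ + 1)) * ‖v‖ < -(c + ⟪gradient g xb, v⟫) := by
      rw [div_mul_eq_mul_div, div_lt_iff₀ (by positivity)]
      nlinarith
    linarith
  have hlo := hstr.isLittleO.def hε
  have ha : Tendsto (fun k => xb + t k • u) atTop (𝓝 xb) := by
    simpa using (ht0.smul_const u).const_add xb
  have hb : Tendsto (fun k => xb + t k • u + ((1 : ℝ) / 2 * (t k) ^ 2) • vk k) atTop (𝓝 xb) := by
    simpa using ha.add (((ht0.pow 2).const_mul ((1:ℝ)/2)).smul hvk)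
  have hev1 := (hb.prodMk_nhds ha).eventually hlo
  have hev2 : ∀ᶠ k in atTop, c + ⟪gradient g xb, vk k⟫ + ε * ‖vk k‖ < 0 := by
    have : Tendsto (fun k => c + ⟪gradient g xb, vk k⟫ + ε * ‖vk k‖) atTop
        (𝓝 (c + ⟪gradient g xb, v⟫ + ε * ‖v‖)) :=
      ((tendsto_const_nhds.inner hvk).const_add c).add (hvk.norm.const_mul ε)
    exact this.eventually_lt_const hεc
  have hev3 : ∀ᶠ k in atTop, t k * ‖u‖ < min r r₀ := by
    have : Tendsto (fun k => t k * ‖u‖) atTop (𝓝 0) := by simpa using ht0.mul_const ‖u‖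
    exact this.eventually_lt_const (lt_min hr hr₀)
  filter_upwards [hev1, hev2, hev3] with k h1 h2 h3
  have h4 := hray (t k) (ht k).le h3
  have htk := ht k
  have hf : fderiv ℝ g xb (vk k) = ⟪gradient g xb, vk k⟫ := by
    rw [gradient, InnerProductSpace.toDual_symm_apply]
  have hpos : 0 < (1 : ℝ) / 2 * (t k) ^ 2 := by positivity
  simp only [add_sub_cancel_left, map_smul, hf, norm_smul, smul_eq_mul] at h1
  rw [Real.norm_eq_abs, Real.norm_eq_abs, abs_of_pos hpos] at h1
  have h5 := (abs_le.1 h1).2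
  nlinarith [mul_neg_of_pos_of_neg hpos h2]
end
end

section
/- Let φ : ℝⁿ → ℝ be of class C^{1,1}, let x̄, u ∈ ℝⁿ and t > 0. Then there exist points σ and σ' on the segment [x̄, x̄ + t u] and vectors ζ ∈ ∂²φ(σ)(u) and ζ' ∈ ∂²φ(σ')(u) such that (1/2) t² ⟨ζ', u⟩ ≤ φ(x̄ + t u) − φ(x̄) − t ⟨∇φ(x̄), u⟩ ≤ (1/2) t² ⟨ζ, u⟩. -/
open Filter Topology RealInnerProductSpace

noncomputable section

theorem frechet_of_quad {n : ℕ} (h : En n → ℝ) (x w : En n) (c L : ℝ)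
    (h1 : ∀ᶠ y in 𝓝 x, ⟪w, y - x⟫ - c * ‖y - x‖ ^ 2 ≤ h y - h x)
    (h2 : ∀ᶠ y in 𝓝 x, h y - h x ≤ L * ‖y - x‖) : w ∈ frechetSubdiff h x := by
  unfold frechetSubdiff
  simp only [Set.mem_ofPred_eq]
  rcases eq_or_neBot (𝓝[≠] x) with hb | hb
  · rw [hb]
    simp [Filter.liminf_eq]
  · have hbd : IsBoundedUnder (· ≤ ·) (𝓝[≠] x)
        (fun y => (h y - h x - ⟪w, y - x⟫) / ‖y - x‖) := by
      refine ⟨L + ‖w‖, ?_⟩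
      rw [eventually_map]
      filter_upwards [h2.filter_mono nhdsWithin_le_nhds, self_mem_nhdsWithin] with y hy hne
      have hpos : 0 < ‖y - x‖ := norm_pos_iff.2 (sub_ne_zero.2 hne)
      rw [div_le_iff₀ hpos]
      have := abs_le.1 (abs_real_inner_le_norm w (y - x))
      nlinarith [this.1]
    refine le_of_forall_pos_le_add fun ε hε => ?_
    have : -ε ≤ Filter.liminf (fun y => (h y - h x - ⟪w, y - x⟫) / ‖y - x‖) (𝓝[≠] x) := by
      refine le_liminf_of_le hbd.isCoboundedUnder_ge ?_
      have ht : Tendsto (fun y : En n => c * ‖y - x‖) (𝓝 x) (𝓝 0) := by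
        have : Continuous (fun y : En n => c * ‖y - x‖) := by fun_prop
        simpa using this.tendsto x
      filter_upwards [h1.filter_mono nhdsWithin_le_nhds, self_mem_nhdsWithin,
        (ht.eventually (gt_mem_nhds hε)).filter_mono nhdsWithin_le_nhds] with y hy hne hs
      have hpos : 0 < ‖y - x‖ := norm_pos_iff.2 (sub_ne_zero.2 hne)
      rw [le_div_iff₀ hpos]
      nlinarith
    linarith

theorem core_mv {n : ℕ} (h : En n → ℝ) (a d : En n) (L : ℝ) (hL : 0 ≤ L)
    (hlip : ∀ x ∈ Metric.closedBall a (‖d‖ + 1), ∀ y ∈ Metric.closedBall a (‖d‖ + 1),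
      |h x - h y| ≤ L * ‖x - y‖) (k : ℝ) (hk : L < k) :
    ∃ s ∈ Set.Icc (0 : ℝ) 1, ∃ x w : En n, w ∈ frechetSubdiff h x ∧ ‖w‖ ≤ 2 * L ∧
      ‖x - (a + s • d)‖ ≤ L / k ∧ h (a + d) - h a - (L ^ 2 + 1) / k ≤ ⟪w, d⟫ := by
  have hk0 : 0 < k := hL.trans_lt hk
  set B := Metric.closedBall a (‖d‖ + 1) with hB
  set D := h (a + d) - h a - (L ^ 2 + 1) / k with hD
  have hcont : ContinuousOn h B := by
    have : LipschitzOnWith (Real.toNNReal L) h B := by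
      refine LipschitzOnWith.of_dist_le_mul fun x hx y hy => ?_
      rw [Real.coe_toNNReal _ hL, Real.dist_eq, dist_eq_norm]
      exact hlip x hx y hy
    exact this.continuousOn
  have haB : a ∈ B := Metric.mem_closedBall_self (by positivity)
  have hpB : ∀ s ∈ Set.Icc (0 : ℝ) 1, ‖(a + s • d) - a‖ ≤ ‖d‖ := by
    intro s hs
    rw [add_sub_cancel_left, norm_smul, Real.norm_eq_abs, abs_of_nonneg hs.1]
    exact mul_le_of_le_one_left (norm_nonneg _) hs.2
  have hpB' : ∀ s ∈ Set.Icc (0 : ℝ) 1, a + s • d ∈ B := by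
    intro s hs
    rw [hB, mem_closedBall_iff_norm]
    linarith [hpB s hs]
  obtain ⟨⟨x, s⟩, ⟨hxB, hs⟩, hmin⟩ := ((isCompact_closedBall a (‖d‖ + 1)).prod
    (isCompact_Icc (a := (0 : ℝ)) (b := 1))).exists_isMinOn
    (f := fun q : En n × ℝ => h q.1 - q.2 * D + k * ‖q.1 - (a + q.2 • d)‖ ^ 2)
    ⟨(a, 0), haB, by simp⟩ (by
      have : ContinuousOn (fun q : En n × ℝ => h q.1) (B ×ˢ Set.Icc (0 : ℝ) 1) :=
        hcont.comp continuousOn_fst fun q hq => hq.1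
      refine (this.sub ?_).add ?_ <;> exact Continuous.continuousOn (by fun_prop))
  simp only at hxB hs
  have hm : ∀ y ∈ B, ∀ r ∈ Set.Icc (0 : ℝ) 1,
      h x - s * D + k * ‖x - (a + s • d)‖ ^ 2 ≤ h y - r * D + k * ‖y - (a + r • d)‖ ^ 2 :=
    fun y hy r hr => hmin (a := (y, r)) ⟨hy, hr⟩
  have hdist : k * ‖x - (a + s • d)‖ ≤ L := by
    rcases (norm_nonneg (x - (a + s • d))).eq_or_lt with h0 | h0
    · rw [← h0]; simpa using hL
    · have h1 := hm _ (hpB' s hs) s hs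
      have h2 := (abs_le.1 (hlip _ hxB _ (hpB' s hs))).1
      simp only [sub_self, norm_zero] at h1
      have : (k * ‖x - (a + s • d)‖) * ‖x - (a + s • d)‖ ≤ L * ‖x - (a + s • d)‖ := by
        nlinarith
      exact le_of_mul_le_mul_right this h0
  have hdist' : ‖x - (a + s • d)‖ ≤ L / k := by
    rw [le_div_iff₀ hk0]; linarith
  have hlt1 : ‖x - (a + s • d)‖ < 1 := hdist'.trans_lt ((div_lt_one hk0).2 hk)
  have hxint : B ∈ 𝓝 x := by
    refine mem_of_superset (Metric.isOpen_ball.mem_nhds (x := x) (s := Metric.ball a (‖d‖ + 1)) ?_)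
      Metric.ball_subset_closedBall
    rw [mem_ball_iff_norm]
    have := norm_add_le (x - (a + s • d)) ((a + s • d) - a)
    rw [sub_add_sub_cancel] at this
    linarith [hpB s hs]
  refine ⟨s, hs, x, (-(2 * k)) • (x - (a + s • d)), ?_, ?_, hdist', ?_⟩
  · refine frechet_of_quad h x _ k L ?_ ?_
    · filter_upwards [hxint] with y hy
      have h1 := hm y hy s hs
      have h2 : ‖y - (a + s • d)‖ ^ 2 = ‖x - (a + s • d)‖ ^ 2
          + 2 * ⟪x - (a + s • d), y - x⟫ + ‖y - x‖ ^ 2 := by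
        rw [← norm_add_sq_real]; congr 2; abel
      rw [real_inner_smul_left]
      rw [h2] at h1
      linarith
    · filter_upwards [hxint] with y hy
      exact (abs_le.1 (hlip y hy x hxB)).2
  · rw [norm_smul, Real.norm_eq_abs, abs_neg, abs_of_pos (by positivity)]
    linarith
  · have hs1 : s < 1 := by
      refine lt_of_le_of_ne hs.2 fun h1 => ?_
      subst h1
      have e1 := hm a haB 0 (by simp)
      simp only [zero_smul, add_zero, sub_self, norm_zero, one_smul] at e1 hdist'
      have e2 := (abs_le.1 (hlip _ hxB _ (hpB' 1 hs))).1
      rw [one_smul] at e2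
      have e3 : L * ‖x - (a + d)‖ ≤ L * (L / k) := mul_le_mul_of_nonneg_left hdist' hL
      have e4 : (L ^ 2 + 1) / k = L * (L / k) + 1 / k := by ring
      have e5 : 0 < 1 / k := by positivity
      have e6 : 0 ≤ k * ‖x - (a + d)‖ ^ 2 := by positivity
      rw [hD, e4] at e1
      nlinarith
    rw [real_inner_smul_left]
    have key : ∀ τ : ℝ, 0 < τ → τ ≤ 1 - s →
        D ≤ -(2 * k) * ⟪x - (a + s • d), d⟫ + τ * (k * ‖d‖ ^ 2) := by
      intro τ h0 h1
      have e1 := hm x hxB (s + τ) ⟨by linarith [hs.1], by linarith⟩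
      have h2 : ‖x - (a + (s + τ) • d)‖ ^ 2 = ‖x - (a + s • d)‖ ^ 2
          - 2 * (τ * ⟪x - (a + s • d), d⟫) + τ ^ 2 * ‖d‖ ^ 2 := by
        have : x - (a + (s + τ) • d) = (x - (a + s • d)) - τ • d := by
          rw [add_smul]; abel
        rw [this, norm_sub_sq_real, real_inner_smul_right, norm_smul, mul_pow,
          Real.norm_eq_abs, sq_abs]
      rw [h2] at e1
      refine le_of_mul_le_mul_left (a := τ) ?_ h0
      linarith
    have ht : Tendsto (fun τ : ℝ => -(2 * k) * ⟪x - (a + s • d), d⟫ + τ * (k * ‖d‖ ^ 2))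
        (𝓝[>] 0) (𝓝 (-(2 * k) * ⟪x - (a + s • d), d⟫)) := by
      have : Continuous (fun τ : ℝ => -(2 * k) * ⟪x - (a + s • d), d⟫ + τ * (k * ‖d‖ ^ 2)) := by
        fun_prop
      simpa using (this.tendsto 0).mono_left nhdsWithin_le_nhds
    refine ge_of_tendsto ht ?_
    filter_upwards [Ioc_mem_nhdsGT (show (0 : ℝ) < 1 - s by linarith)] with τ hτ
    exact key τ hτ.1 hτ.2

theorem mv_limiting {n : ℕ} (h : En n → ℝ) (hh : LocallyLipschitz h) (a d : En n) :
    ∃ s ∈ Set.Icc (0 : ℝ) 1, ∃ ζ ∈ limitingSubdiff h (a + s • d),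
      h (a + d) - h a ≤ ⟪ζ, d⟫ := by
  obtain ⟨K, hK⟩ := hh.locallyLipschitzOn.exists_lipschitzOnWith_of_compact
    (isCompact_closedBall a (‖d‖ + 1))
  have hlip : ∀ x ∈ Metric.closedBall a (‖d‖ + 1), ∀ y ∈ Metric.closedBall a (‖d‖ + 1),
      |h x - h y| ≤ K * ‖x - y‖ := by
    intro x hx y hy
    have := hK.dist_le_mul x hx y hy
    rwa [Real.dist_eq, dist_eq_norm] at this
  have hcore := fun m : ℕ => core_mv h a d K K.2 hlip (K + (m + 1)) (by
    have : (0 : ℝ) < m + 1 := by positivity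
    linarith)
  choose s hs x w hw hwn hx hi using hcore
  obtain ⟨⟨s0, ζ⟩, ⟨hs0, -⟩, f, hf, hlim⟩ := ((isCompact_Icc (a := (0 : ℝ)) (b := 1)).prod
    (isCompact_closedBall (0 : En n) (2 * K))).tendsto_subseq (x := fun m => (s m, w m))
    (fun m => ⟨hs m, by simpa using hwn m⟩)
  rw [Prod.tendsto_iff] at hlim
  obtain ⟨l1, l2⟩ := hlim
  simp only [Function.comp_def] at l1 l2
  have hden : Tendsto (fun m : ℕ => (K : ℝ) + ((m : ℝ) + 1)) atTop atTop :=
    tendsto_atTop_add_const_left _ _ (tendsto_atTop_add_const_right _ _ tendsto_natCast_atTop_atTop)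
  have hz : ∀ c : ℝ, Tendsto (fun m : ℕ => c / ((K : ℝ) + ((m : ℝ) + 1))) atTop (𝓝 0) :=
    fun c => hden.const_div_atTop c
  refine ⟨s0, hs0, ζ, ⟨fun m => x (f m), fun m => w (f m), ?_, l2, fun m => hw _⟩, ?_⟩
  · have e1 : Tendsto (fun m => x (f m) - (a + s (f m) • d)) atTop (𝓝 0) :=
      squeeze_zero_norm (fun m => hx (f m)) ((hz K).comp hf.tendsto_atTop)
    have e2 : Tendsto (fun m => a + s (f m) • d) atTop (𝓝 (a + s0 • d)) :=
      tendsto_const_nhds.add (l1.smul_const d)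
    simpa using e1.add e2
  · have e1 : Tendsto (fun m => h (a + d) - h a - ((K : ℝ) ^ 2 + 1) / ((K : ℝ) + ((f m : ℝ) + 1)))
        atTop (𝓝 (h (a + d) - h a - 0)) :=
      tendsto_const_nhds.sub ((hz _).comp hf.tendsto_atTop)
    rw [sub_zero] at e1
    exact le_of_tendsto_of_tendsto' e1 (l2.inner tendsto_const_nhds) fun m => hi (f m)

/-- second-order Taylor inequalities along a ray. -/
theorem stmt17 {n : ℕ} (φ : En n → ℝ) (hφ : IsC11 φ) (xb u : En n)
    (t : ℝ) (ht : 0 < t) :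
    ∃ σ ∈ segment ℝ xb (xb + t • u), ∃ σ' ∈ segment ℝ xb (xb + t • u),
      ∃ ζ ∈ secondSubdiff φ σ u, ∃ ζ' ∈ secondSubdiff φ σ' u,
        (1 / 2 : ℝ) * t ^ 2 * ⟪ζ', u⟫ ≤ φ (xb + t • u) - φ xb - t * ⟪gradient φ xb, u⟫ ∧
        φ (xb + t • u) - φ xb - t * ⟪gradient φ xb, u⟫ ≤ (1 / 2 : ℝ) * t ^ 2 * ⟪ζ, u⟫ := by
  have hloc : LocallyLipschitz (fun x => ⟪u, gradient φ x⟫) := by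
    have : LipschitzWith ‖innerSL ℝ u‖₊ (innerSL ℝ u) := (innerSL ℝ u).lipschitz
    exact this.locallyLipschitz.comp hφ.2
  set R := (φ (xb + t • u) - φ xb - t * ⟪gradient φ xb, u⟫) / (t ^ 2 / 2) with hR
  have hRe : φ (xb + t • u) - φ xb - t * ⟪gradient φ xb, u⟫ = (1 / 2 : ℝ) * t ^ 2 * R := by
    rw [hR]; field_simp
  have hder : ∀ s : ℝ, HasDerivAt
      (fun s : ℝ => φ (xb + s • u) - s * ⟪gradient φ xb, u⟫ - R / 2 * s ^ 2)
      (⟪gradient φ (xb + s • u), u⟫ - ⟪gradient φ xb, u⟫ - R * s) s := by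
    intro s
    have h1 : HasDerivAt (fun s : ℝ => xb + s • u) u s := by
      simpa using ((hasDerivAt_id s).smul_const u).const_add xb
    have h2 := (hφ.1 (xb + s • u)).hasGradientAt.hasFDerivAt.comp_hasDerivAt s h1
    have h3 := (hasDerivAt_id s).mul_const ⟪gradient φ xb, u⟫
    have h4 := ((hasDerivAt_id s).pow 2).const_mul (R / 2)
    refine ((h2.sub h3).sub h4).congr_deriv ?_
    simp
    ring
  obtain ⟨τ, hτ, h0⟩ := exists_hasDerivAt_eq_zero ht
    (fun s _ => (hder s).continuousAt.continuousWithinAt)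
    (by simp only [zero_smul, add_zero]; linarith) (fun s _ => hder s)
  have hτ0 : 0 < τ := hτ.1
  have hmem : ∀ r ∈ Set.Icc (0 : ℝ) 1, xb + (r * τ) • u ∈ segment ℝ xb (xb + t • u) := by
    intro r hr
    rw [segment_eq_image']
    refine ⟨r * τ / t, ⟨by have := hr.1; positivity, ?_⟩, ?_⟩
    · rw [div_le_one ht]; nlinarith [hr.1, hr.2, hτ.2]
    · simp only [add_sub_cancel_left, smul_smul]
      rw [div_mul_cancel₀ _ ht.ne']
  obtain ⟨s, hs, ζ, hζ, hi⟩ := mv_limiting _ hloc xb (τ • u)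
  obtain ⟨s', hs', ζ', hζ', hi'⟩ := mv_limiting _ hloc (xb + τ • u) (-(τ • u))
  rw [smul_smul] at hζ
  have e : xb + τ • u + s' • -(τ • u) = xb + ((1 - s') * τ) • u := by
    rw [sub_mul, one_mul, sub_smul, smul_neg, smul_smul]; abel
  rw [e] at hζ'
  simp only [add_neg_cancel_right, inner_neg_right, real_inner_smul_right] at hi hi'
  rw [real_inner_comm, real_inner_comm u] at h0
  refine ⟨_, hmem s hs, _, hmem (1 - s') ⟨by linarith [hs'.2], by linarith [hs'.1]⟩,
    ζ, hζ, ζ', hζ', ?_, ?_⟩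
  · rw [hRe]
    refine mul_le_mul_of_nonneg_left ?_ (by positivity)
    refine le_of_mul_le_mul_left (a := τ) ?_ hτ0
    linarith
  · rw [hRe]
    refine mul_le_mul_of_nonneg_left ?_ (by positivity)
    refine le_of_mul_le_mul_left (a := τ) ?_ hτ0
    linarith
end
end
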